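/- arXiv:1602.00034 — 17 statements merged into one kernel-verified Lean document; each statement's English description precedes it below -/
import Mathlib

section
/- Let P be a finite partially ordered set in which every pair of elements has a least upper bound. Then every pair f, g ∈ Δ(P) has a least upper bound f ∨ g in the pointwise order on Δ(P), and f ∨ g is the unique element of Δ(P) such that for every t ∈ (0,1], the generator of the principal ideal (f ∨ g)_t is the least upper bound in P of the generator of f_t and the generator of g_t. -/
/-- `Delta P` is the set of functions `f : P → [0,1]` such that for every `t ∈ (0,1]`,
the set `f_t = {x | f x ≥ t}` is a principal ideal of `P`, i.e. of the form `↓x`. -/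
def Delta (P : Type*) [PartialOrder P] : Set (P → unitInterval) :=
  {f | ∀ t : unitInterval, 0 < t → ∃ x : P, {y : P | t ≤ f y} = Set.Iic x}

open Classical in
/-- The join of `f` and `g` in `Delta P`: the value at `x` is the largest `min (f a) (g b)`
over all pairs with `x ≤ a ⊔ b`. -/
noncomputable def deltaJoin {P : Type*} [Fintype P] [SemilatticeSup P]
    (f g : P → unitInterval) (x : P) : unitInterval :=
  (Finset.univ.filter fun p : P × P => x ≤ p.1 ⊔ p.2).sup fun p => f p.1 ⊓ g p.2

theorem le_deltaJoin_iff {P : Type*} [Fintype P] [SemilatticeSup P]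
    (f g : P → unitInterval) {t : unitInterval} (ht : 0 < t) (x : P) :
    t ≤ deltaJoin f g x ↔ ∃ a b, x ≤ a ⊔ b ∧ t ≤ f a ∧ t ≤ g b := by
  rw [deltaJoin, Finset.le_sup_iff (show ⊥ < t from ht)]
  simp

theorem setOf_le_deltaJoin {P : Type*} [Fintype P] [SemilatticeSup P]
    {f g : P → unitInterval} {t : unitInterval} (ht : 0 < t) {a b : P}
    (ha : {x : P | t ≤ f x} = Set.Iic a) (hb : {x : P | t ≤ g x} = Set.Iic b) :
    {x : P | t ≤ deltaJoin f g x} = Set.Iic (a ⊔ b) := by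
  simp only [Set.ext_iff, Set.mem_ofPred_eq, Set.mem_Iic] at ha hb ⊢
  intro x
  simp only [le_deltaJoin_iff f g ht, ha, hb]
  exact ⟨fun ⟨_, _, hx, hc, hd⟩ => hx.trans (sup_le_sup hc hd),
    fun hx => ⟨a, b, hx, le_rfl, le_rfl⟩⟩

theorem le_of_forall_pos_le {P : Type*} {f g : P → unitInterval}
    (h : ∀ t : unitInterval, 0 < t → ∀ x, t ≤ f x → t ≤ g x) : f ≤ g := fun x =>
  (eq_or_lt_of_le (unitInterval.nonneg' (t := f x))).elim
    (fun h0 => h0 ▸ unitInterval.nonneg') fun h0 => h _ h0 x le_rfl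

/-- If `P` is a finite poset with least upper bounds of pairs, then every pair
`f, g ∈ Δ(P)` has a least upper bound `j` in the pointwise order on `Δ(P)`, and `j` is
the unique element of `Δ(P)` such that for every `t ∈ (0,1]` the generator of the
principal ideal `j_t` is the join in `P` of the generators of `f_t` and `g_t`. -/
theorem stmt1 {P : Type*} [Fintype P] [SemilatticeSup P]
    (f g : P → unitInterval) (hf : f ∈ Delta P) (hg : g ∈ Delta P) :
    ∃ j ∈ Delta P,
      (f ≤ j ∧ g ≤ j ∧ ∀ k ∈ Delta P, f ≤ k → g ≤ k → j ≤ k) ∧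
      (∀ t : unitInterval, 0 < t → ∀ a b : P,
        {x : P | t ≤ f x} = Set.Iic a → {x : P | t ≤ g x} = Set.Iic b →
        {x : P | t ≤ j x} = Set.Iic (a ⊔ b)) ∧
      (∀ j' ∈ Delta P,
        (∀ t : unitInterval, 0 < t → ∀ a b : P,
          {x : P | t ≤ f x} = Set.Iic a → {x : P | t ≤ g x} = Set.Iic b →
          {x : P | t ≤ j' x} = Set.Iic (a ⊔ b)) → j' = j) := by
  have hj := fun (t : unitInterval) (ht : 0 < t) (a b : P) =>
    setOf_le_deltaJoin (f := f) (g := g) ht (a := a) (b := b)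
  refine ⟨deltaJoin f g, ?_, ⟨?_, ?_, ?_⟩, hj, ?_⟩
  · intro t ht
    obtain ⟨a, ha⟩ := hf t ht
    obtain ⟨b, hb⟩ := hg t ht
    exact ⟨a ⊔ b, hj t ht a b ha hb⟩
  · refine le_of_forall_pos_le fun t ht x hx => ?_
    obtain ⟨b, hb⟩ := hg t ht
    exact (le_deltaJoin_iff f g ht x).2
      ⟨x, b, le_sup_left, hx, (Set.ext_iff.1 hb b).2 Set.self_mem_Iic⟩
  · refine le_of_forall_pos_le fun t ht x hx => ?_
    obtain ⟨a, ha⟩ := hf t ht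
    exact (le_deltaJoin_iff f g ht x).2
      ⟨a, x, le_sup_right, (Set.ext_iff.1 ha a).2 Set.self_mem_Iic, hx⟩
  · intro k hk hfk hgk
    refine le_of_forall_pos_le fun t ht x hx => ?_
    obtain ⟨a, b, hxab, ha, hb⟩ := (le_deltaJoin_iff f g ht x).1 hx
    obtain ⟨c, hc⟩ := hk t ht
    have hac : a ≤ c := (Set.ext_iff.1 hc a).1 (ha.trans (hfk a))
    have hbc : b ≤ c := (Set.ext_iff.1 hc b).1 (hb.trans (hgk b))
    exact (Set.ext_iff.1 hc x).2 (hxab.trans (sup_le hac hbc))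
  · intro j' _ h
    have key : ∀ t : unitInterval, 0 < t → ∀ x, t ≤ j' x ↔ t ≤ deltaJoin f g x := by
      intro t ht x
      obtain ⟨a, ha⟩ := hf t ht
      obtain ⟨b, hb⟩ := hg t ht
      exact Set.ext_iff.1 ((h t ht a b ha hb).trans (hj t ht a b ha hb).symm) x
    exact le_antisymm (le_of_forall_pos_le fun t ht x => (key t ht x).1)
      (le_of_forall_pos_le fun t ht x => (key t ht x).2)
end

section
/- Let L be a finite (nonempty) lattice with least element 0. A function f : L → [0,1] belongs to Δ(L) if and only if f(0) = 1 and f(x ∨ y) = min(f(x), f(y)) for all x, y ∈ L. -/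
/-- For a finite lattice `L` with least element `0 = ⊥`, a function `f : L → [0,1]`
belongs to `Δ(L)` if and only if `f ⊥ = 1` and `f (x ⊔ y) = min (f x) (f y)` for all
`x, y ∈ L`. -/
theorem stmt2 {L : Type*} [Fintype L] [Lattice L] [OrderBot L]
    (f : L → unitInterval) :
    f ∈ Delta L ↔ f ⊥ = 1 ∧ ∀ x y : L, f (x ⊔ y) = min (f x) (f y) := by
  constructor
  · intro hf
    -- Every positive lower bound `t` cuts out a principal ideal, hence a set closed under joins.
    have hmem : ∀ t : unitInterval, 0 < t → ∃ z : L, ∀ y, t ≤ f y ↔ y ≤ z := fun t ht ↦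
      (hf t ht).imp fun z hz y ↦ Set.ext_iff.mp hz y
    have hanti : Antitone f := by
      intro x y hxy
      rcases (unitInterval.nonneg' : 0 ≤ f y).eq_or_lt with h | h
      · exact h ▸ unitInterval.nonneg'
      · obtain ⟨z, hz⟩ := hmem _ h
        exact (hz x).2 (hxy.trans ((hz y).1 le_rfl))
    refine ⟨?_, fun x y ↦ le_antisymm (le_min (hanti le_sup_left) (hanti le_sup_right)) ?_⟩
    · obtain ⟨z, hz⟩ := hmem 1 zero_lt_one
      exact le_antisymm unitInterval.le_one' ((hz ⊥).2 bot_le)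
    · rcases (unitInterval.nonneg' : 0 ≤ min (f x) (f y)).eq_or_lt with h | h
      · exact h ▸ unitInterval.nonneg'
      · obtain ⟨z, hz⟩ := hmem _ h
        exact (hz _).2 (sup_le ((hz x).1 (min_le_left _ _)) ((hz y).1 (min_le_right _ _)))
  · rintro ⟨hbot, hsup⟩ t -
    classical
    have hanti : Antitone f := fun x y hxy ↦ by
      have h := hsup x y
      rw [sup_eq_right.2 hxy] at h
      exact h ▸ min_le_left _ _
    let s : Finset L := {y | t ≤ f y}
    have hs : t ≤ f (s.sup id) := by
      refine Finset.sup_induction (p := fun y ↦ t ≤ f y) ?_ ?_ ?_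
      · exact hbot ▸ unitInterval.le_one'
      · exact fun x hx y hy ↦ hsup x y ▸ le_min hx hy
      · exact fun y hy ↦ (Finset.mem_filter.1 hy).2
    refine ⟨s.sup id, Set.ext fun y ↦ ⟨fun hy ↦ ?_, fun hy ↦ hs.trans (hanti hy)⟩⟩
    exact Finset.le_sup (f := id) (Finset.mem_filter.2 ⟨Finset.mem_univ y, hy⟩)
end

section
/- Let L be a finite (nonempty) lattice. Then Δ(L), with the pointwise partial order and the subspace topology inherited from the product space [0,1]^L, is a topological lattice: every pair f, g ∈ Δ(L) has a greatest lower bound f ∧ g and a least upper bound f ∨ g in Δ(L), and the maps (f,g) ↦ f ∧ g and (f,g) ↦ f ∨ g from Δ(L) × Δ(L) to Δ(L) are continuous. -/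
namespace Delta

/-- A pointwise inequality in `[0,1]` may be checked on positive lower bounds. -/
lemma le_of_forall_pos {a b : unitInterval} (h : ∀ t, 0 < t → t ≤ a → t ≤ b) : a ≤ b := by
  rcases eq_or_lt_of_le (unitInterval.nonneg' (t := a)) with h0 | h0
  · exact h0 ▸ unitInterval.nonneg'
  · exact h a h0 le_rfl

lemma inf_mem {L : Type*} [Lattice L] {f g : L → unitInterval}
    (hf : f ∈ Delta L) (hg : g ∈ Delta L) : f ⊓ g ∈ Delta L := by
  intro t ht
  obtain ⟨x, hx⟩ := hf t ht
  obtain ⟨y, hy⟩ := hg t ht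
  refine ⟨x ⊓ y, ?_⟩
  rw [← Set.Iic_inter_Iic, ← hx, ← hy]
  ext z
  simp

open Classical in
/-- The function whose `t`-superlevel set is `{z | ∃ a b, z ≤ a ⊔ b, t ≤ f a, t ≤ g b}`
for every `t > 0`. -/
noncomputable def joinFun {L : Type*} [Fintype L] [Lattice L] (f g : L → unitInterval) (z : L) :
    unitInterval :=
  ({p : L × L | z ≤ p.1 ⊔ p.2} : Finset (L × L)).sup fun p => f p.1 ⊓ g p.2

variable {L : Type*} [Fintype L] [Lattice L]

lemma le_joinFun_iff {f g : L → unitInterval} {z : L} {t : unitInterval} (ht : 0 < t) :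
    t ≤ joinFun f g z ↔ ∃ a b, z ≤ a ⊔ b ∧ t ≤ f a ∧ t ≤ g b := by
  rw [joinFun, Finset.le_sup_iff (show ⊥ < t from ht)]
  simp

lemma joinFun_mem {f g : L → unitInterval} (hf : f ∈ Delta L) (hg : g ∈ Delta L) :
    joinFun f g ∈ Delta L := by
  intro t ht
  obtain ⟨x, hx⟩ := hf t ht
  obtain ⟨y, hy⟩ := hg t ht
  simp only [Set.ext_iff, Set.mem_ofPred_eq, Set.mem_Iic] at hx hy
  refine ⟨x ⊔ y, ?_⟩
  ext z
  simp only [Set.mem_ofPred_eq, Set.mem_Iic, le_joinFun_iff ht, hx, hy]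
  exact ⟨fun ⟨a, b, hz, ha, hb⟩ => hz.trans (sup_le_sup ha hb),
    fun hz => ⟨x, y, hz, le_rfl, le_rfl⟩⟩

lemma le_joinFun_left {f g : L → unitInterval} (hg : g ∈ Delta L) : f ≤ joinFun f g := by
  refine fun z => le_of_forall_pos fun t ht hz => ?_
  obtain ⟨y, hy⟩ := hg t ht
  exact (le_joinFun_iff ht).2 ⟨z, y, le_sup_left, hz, hy.ge (Set.mem_Iic.2 le_rfl)⟩

lemma le_joinFun_right {f g : L → unitInterval} (hf : f ∈ Delta L) : g ≤ joinFun f g := by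
  refine fun z => le_of_forall_pos fun t ht hz => ?_
  obtain ⟨x, hx⟩ := hf t ht
  exact (le_joinFun_iff ht).2 ⟨x, z, le_sup_right, hx.ge (Set.mem_Iic.2 le_rfl), hz⟩

lemma joinFun_le {f g k : L → unitInterval} (hk : k ∈ Delta L) (hfk : f ≤ k) (hgk : g ≤ k) :
    joinFun f g ≤ k := by
  refine fun z => le_of_forall_pos fun t ht hz => ?_
  obtain ⟨a, b, hab, ha, hb⟩ := (le_joinFun_iff ht).1 hz
  obtain ⟨w, hw⟩ := hk t ht
  have haw : a ≤ w := hw.le (ha.trans (hfk a))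
  have hbw : b ≤ w := hw.le (hb.trans (hgk b))
  exact hw.ge (hab.trans (sup_le haw hbw))

lemma continuous_joinFun :
    Continuous fun p : (L → unitInterval) × (L → unitInterval) => joinFun p.1 p.2 := by
  refine continuous_pi fun z => ?_
  unfold joinFun
  exact Continuous.finset_sup_apply fun q _ => by fun_prop

end Delta

/-- For a finite nonempty lattice `L`, the set `Δ(L)`, with the pointwise partial order
and the subspace topology from the product space `[0,1]^L`, is a topological lattice:
every pair of elements has a greatest lower bound and a least upper bound, and these
two binary operations are continuous. -/
theorem stmt3 {L : Type*} [Fintype L] [Lattice L] [Nonempty L] :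
    ∃ meet join : ↥(Delta L) → ↥(Delta L) → ↥(Delta L),
      (∀ f g : ↥(Delta L), IsGLB {f, g} (meet f g)) ∧
      (∀ f g : ↥(Delta L), IsLUB {f, g} (join f g)) ∧
      Continuous (fun p : ↥(Delta L) × ↥(Delta L) => meet p.1 p.2) ∧
      Continuous (fun p : ↥(Delta L) × ↥(Delta L) => join p.1 p.2) := by
  refine ⟨fun f g => ⟨f.1 ⊓ g.1, Delta.inf_mem f.2 g.2⟩,
    fun f g => ⟨Delta.joinFun f.1 g.1, Delta.joinFun_mem f.2 g.2⟩, fun f g => ⟨?_, ?_⟩,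
    fun f g => ⟨?_, ?_⟩, ?_, ?_⟩
  · rintro _ (rfl | rfl)
    · exact Subtype.coe_le_coe.1 inf_le_left
    · exact Subtype.coe_le_coe.1 inf_le_right
  · intro k hk
    exact Subtype.coe_le_coe.1 (le_inf (hk (Or.inl rfl)) (hk (Or.inr rfl)))
  · rintro _ (rfl | rfl)
    · exact Subtype.coe_le_coe.1 (Delta.le_joinFun_left g.2)
    · exact Subtype.coe_le_coe.1 (Delta.le_joinFun_right f.2)
  · intro k hk
    exact Subtype.coe_le_coe.1 (Delta.joinFun_le k.2 (hk (Or.inl rfl)) (hk (Or.inr rfl)))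
  · refine Continuous.subtype_mk (continuous_pi fun z => ?_) _
    have h : Continuous fun f : Delta L => f.1 z :=
      (continuous_apply z).comp continuous_subtype_val
    exact (h.comp continuous_fst).inf (h.comp continuous_snd)
  · exact (Delta.continuous_joinFun.comp
      (continuous_subtype_val.prodMap continuous_subtype_val)).subtype_mk _
end

section
/- Let L be a finite (nonempty) lattice. For each t ∈ (0,1], let h_t : Δ(L) → L send f to the generator of the principal ideal f_t = {x ∈ L | f(x) ≥ t}. Then each h_t is a lattice homomorphism, i.e. h_t(f ∧ g) = h_t(f) ∧ h_t(g) and h_t(f ∨ g) = h_t(f) ∨ h_t(g) for all f, g ∈ Δ(L), and the family (h_t)_{t ∈ (0,1]} separates points: if h_t(f) = h_t(g) for all t ∈ (0,1], then f = g. (Thus Δ(L) is a subdirect product of copies of L.) -/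
/-- The level set of a pointwise infimum is generated by the meet of the generators. -/
theorem setOf_le_inf_eq_Iic {L : Type*} [Lattice L] {f g : L → unitInterval} {t : unitInterval}
    {a b : L} (hf : {x | t ≤ f x} = Set.Iic a) (hg : {x | t ≤ g x} = Set.Iic b) :
    {x | t ≤ (f ⊓ g) x} = Set.Iic (a ⊓ b) := by
  rw [← Set.Iic_inter_Iic, ← hf, ← hg]
  ext x
  simp

theorem inf_mem_Delta {L : Type*} [Lattice L] {f g : L → unitInterval}
    (hf : f ∈ Delta L) (hg : g ∈ Delta L) : f ⊓ g ∈ Delta L := fun t ht => by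
  obtain ⟨a, ha⟩ := hf t ht
  obtain ⟨b, hb⟩ := hg t ht
  exact ⟨a ⊓ b, setOf_le_inf_eq_Iic ha hb⟩

open Classical in
/-- The sup-convolution of `f` and `g`, which is their join in `Delta L`. -/
noncomputable def supConvolution {L : Type*} [Fintype L] [Lattice L] (f g : L → unitInterval) :
    L → unitInterval :=
  fun x => (Finset.univ.filter fun p : L × L => x ≤ p.1 ⊔ p.2).sup fun p => f p.1 ⊓ g p.2

/-- The level set of a sup-convolution is generated by the join of the generators. -/
theorem setOf_le_supConvolution_eq_Iic {L : Type*} [Fintype L] [Lattice L]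
    {f g : L → unitInterval} {t : unitInterval} (ht : 0 < t) {a b : L}
    (hf : {x | t ≤ f x} = Set.Iic a) (hg : {x | t ≤ g x} = Set.Iic b) :
    {x | t ≤ supConvolution f g x} = Set.Iic (a ⊔ b) := by
  have hf' : ∀ x, t ≤ f x ↔ x ≤ a := Set.ext_iff.mp hf
  have hg' : ∀ x, t ≤ g x ↔ x ≤ b := Set.ext_iff.mp hg
  ext x
  simp only [supConvolution, Set.mem_ofPred_eq, Set.mem_Iic,
    Finset.le_sup_iff (show (⊥ : unitInterval) < t from ht), Finset.mem_filter,
    Finset.mem_univ, true_and, le_inf_iff, hf', hg', Prod.exists]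
  constructor
  · rintro ⟨y, z, hx, hy, hz⟩
    exact hx.trans (sup_le_sup hy hz)
  · exact fun hx => ⟨a, b, hx, le_rfl, le_rfl⟩

theorem supConvolution_mem_Delta {L : Type*} [Fintype L] [Lattice L] {f g : L → unitInterval}
    (hf : f ∈ Delta L) (hg : g ∈ Delta L) : supConvolution f g ∈ Delta L := fun t ht => by
  obtain ⟨a, ha⟩ := hf t ht
  obtain ⟨b, hb⟩ := hg t ht
  exact ⟨a ⊔ b, setOf_le_supConvolution_eq_Iic ht ha hb⟩

/-- Functions are compared pointwise by comparing their level sets at positive heights. -/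
theorem le_of_forall_pos_setOf_le_subset {α : Type*} {f g : α → unitInterval}
    (h : ∀ t, 0 < t → {x | t ≤ f x} ⊆ {x | t ≤ g x}) : f ≤ g := fun x => by
  rcases eq_or_lt_of_le (unitInterval.nonneg' (t := f x)) with h0 | h0
  · exact h0 ▸ unitInterval.nonneg'
  · exact h (f x) h0 (le_refl (f x))

theorem le_supConvolution_left {L : Type*} [Fintype L] [Lattice L] {f g : L → unitInterval}
    (hf : f ∈ Delta L) (hg : g ∈ Delta L) : f ≤ supConvolution f g :=
  le_of_forall_pos_setOf_le_subset fun t ht => by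
    obtain ⟨a, ha⟩ := hf t ht
    obtain ⟨b, hb⟩ := hg t ht
    rw [setOf_le_supConvolution_eq_Iic ht ha hb, ha]
    exact Set.Iic_subset_Iic.mpr le_sup_left

theorem le_supConvolution_right {L : Type*} [Fintype L] [Lattice L] {f g : L → unitInterval}
    (hf : f ∈ Delta L) (hg : g ∈ Delta L) : g ≤ supConvolution f g :=
  le_of_forall_pos_setOf_le_subset fun t ht => by
    obtain ⟨a, ha⟩ := hf t ht
    obtain ⟨b, hb⟩ := hg t ht
    rw [setOf_le_supConvolution_eq_Iic ht ha hb, hb]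
    exact Set.Iic_subset_Iic.mpr le_sup_right

/-- The generator of a level set is monotone in the function. -/
theorem generator_le_of_le {P : Type*} [PartialOrder P] {f g : P → unitInterval}
    {t : unitInterval} {a b : P} (hfg : f ≤ g) (hf : {x | t ≤ f x} = Set.Iic a)
    (hg : {x | t ≤ g x} = Set.Iic b) : a ≤ b := by
  rw [← Set.Iic_subset_Iic, ← hf, ← hg]
  exact fun x hx => le_trans hx (hfg x)

/-- For a finite nonempty lattice `L` and `t ∈ (0,1]`, the map `h_t : Δ(L) → L` sending
`f` to the generator of the principal ideal `f_t` is a lattice homomorphism (it sends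
meets in `Δ(L)` to meets in `L` and joins to joins), and the family `(h_t)` for
`t ∈ (0,1]` separates points of `Δ(L)`.  (Here meets and joins in `Δ(L)` are the
greatest lower bounds and least upper bounds for the pointwise order, and the
generator of `f_t` is expressed by the hypothesis `f_t = Set.Iic a`.) -/
theorem stmt4 {L : Type*} [Fintype L] [Lattice L] [Nonempty L] :
    (∀ t : unitInterval, 0 < t →
      ∀ f g m : ↥(Delta L), IsGLB {f, g} m →
        ∀ a b c : L,
          {x : L | t ≤ (f : L → unitInterval) x} = Set.Iic a →
          {x : L | t ≤ (g : L → unitInterval) x} = Set.Iic b →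
          {x : L | t ≤ (m : L → unitInterval) x} = Set.Iic c →
          c = a ⊓ b) ∧
    (∀ t : unitInterval, 0 < t →
      ∀ f g j : ↥(Delta L), IsLUB {f, g} j →
        ∀ a b c : L,
          {x : L | t ≤ (f : L → unitInterval) x} = Set.Iic a →
          {x : L | t ≤ (g : L → unitInterval) x} = Set.Iic b →
          {x : L | t ≤ (j : L → unitInterval) x} = Set.Iic c →
          c = a ⊔ b) ∧
    (∀ f g : ↥(Delta L),
      (∀ t : unitInterval, 0 < t → ∀ a b : L,
        {x : L | t ≤ (f : L → unitInterval) x} = Set.Iic a →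
        {x : L | t ≤ (g : L → unitInterval) x} = Set.Iic b → a = b) →
      f = g) := by
  refine ⟨?_, ?_, ?_⟩
  · intro t _ f g m hm a b c ha hb hc
    have hmf : m ≤ f := hm.1 (Set.mem_insert _ _)
    have hmg : m ≤ g := hm.1 (Set.mem_insert_of_mem _ rfl)
    have hle : (⟨f.1 ⊓ g.1, inf_mem_Delta f.2 g.2⟩ : ↥(Delta L)) ≤ m := hm.2 <| by
      rintro k (rfl | rfl)
      · exact inf_le_left (a := k.1)
      · exact inf_le_right (b := k.1)
    exact le_antisymm (le_inf (generator_le_of_le hmf hc ha) (generator_le_of_le hmg hc hb))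
      (generator_le_of_le hle (setOf_le_inf_eq_Iic ha hb) hc)
  · intro t ht f g j hj a b c ha hb hc
    have hfj : f ≤ j := hj.1 (Set.mem_insert _ _)
    have hgj : g ≤ j := hj.1 (Set.mem_insert_of_mem _ rfl)
    have hle : j ≤ (⟨supConvolution f.1 g.1, supConvolution_mem_Delta f.2 g.2⟩ : ↥(Delta L)) :=
      hj.2 <| by
        rintro k (rfl | rfl)
        · exact le_supConvolution_left k.2 g.2
        · exact le_supConvolution_right f.2 k.2
    exact le_antisymm (generator_le_of_le hle hc (setOf_le_supConvolution_eq_Iic ht ha hb))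
      (sup_le (generator_le_of_le hfj ha hc) (generator_le_of_le hgj hb hc))
  · intro f g h
    have heq : ∀ t, 0 < t → {x | t ≤ f.1 x} = {x | t ≤ g.1 x} := fun t ht => by
      obtain ⟨a, ha⟩ := f.2 t ht
      obtain ⟨b, hb⟩ := g.2 t ht
      rw [ha, hb, h t ht a b ha hb]
    exact Subtype.ext (le_antisymm
      (le_of_forall_pos_setOf_le_subset fun t ht => (heq t ht).subset)
      (le_of_forall_pos_setOf_le_subset fun t ht => (heq t ht).superset))
end

section
/- Let X be a finite set and L a family of subsets of X which, partially ordered by inclusion, forms a lattice: for every a, b ∈ L there is a least member of L containing a ∪ b and a greatest member of L contained in a ∩ b. Let Δ(X,L) be the set of functions f : X → [0,1] such that for every t ∈ (0,1] the set f_t = {y ∈ X | f(y) ≥ t} belongs to L, ordered pointwise. Then the map sending f ∈ Δ(X,L) to the function F : L → [0,1] defined by F(A) = min_{x∈A} f(x) for nonempty A ∈ L and F(∅) = 1 (if ∅ ∈ L) is an order isomorphism of Δ(X,L) onto Δ(L), where L is regarded as a finite lattice under inclusion. In particular Δ(X,L) is a lattice under the pointwise order. -/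
/-- `DeltaXL X L` is the set of functions `f : X → [0,1]` such that for every
`t ∈ (0,1]` the set `f_t = {y | f y ≥ t}` belongs to the family `L` of subsets of `X`,
ordered pointwise. -/
def DeltaXL (X : Type*) (L : Set (Set X)) : Set (X → unitInterval) :=
  {f | ∀ t : unitInterval, 0 < t → {y : X | t ≤ f y} ∈ L}

/-- The function `A ↦ min_{x ∈ A} f x` on `L`, with value `1` at the empty set. -/
noncomputable def minMem {X : Type*} {L : Set (Set X)} (f : X → unitInterval) (A : L) :
    unitInterval :=
  ⨅ x ∈ A.1, f x

/-- The candidate inverse of `minMem`, sending `F` to `x ↦ max {F A | x ∈ A ∈ L}`. -/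
noncomputable def maxMem {X : Type*} {L : Set (Set X)} (F : L → unitInterval) (x : X) :
    unitInterval :=
  ⨆ A : {A : L // x ∈ A.1}, F A.1

theorem le_minMem_iff {X : Type*} {L : Set (Set X)} {f : X → unitInterval} {A : L}
    {t : unitInterval} : t ≤ minMem f A ↔ A.1 ⊆ {y | t ≤ f y} := by
  simp [minMem, Set.subset_def]

theorem le_maxMem_iff {X : Type*} [Finite X] {L : Set (Set X)} {F : L → unitInterval} {x : X}
    {t : unitInterval} (ht : 0 < t) : t ≤ maxMem F x ↔ ∃ A : L, x ∈ A.1 ∧ t ≤ F A := by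
  constructor
  · intro h
    rcases isEmpty_or_nonempty {A : L // x ∈ A.1} with hE | hE
    · rw [maxMem, iSup_of_empty] at h
      exact absurd ht (not_lt_of_ge h)
    · obtain ⟨A, hA⟩ := exists_eq_ciSup_of_finite (f := fun A : {A : L // x ∈ A.1} => F A.1)
      exact ⟨A.1, A.2, h.trans hA.ge⟩
  · rintro ⟨A, hx, h⟩
    exact h.trans (le_iSup (fun A : {A : L // x ∈ A.1} => F A.1) ⟨A, hx⟩)

theorem eq_of_forall_pos_le_iff {a b : unitInterval} (h : ∀ t, 0 < t → (t ≤ a ↔ t ≤ b)) :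
    a = b := by
  refine eq_of_forall_le_iff fun t => ?_
  rcases eq_or_lt_of_le (unitInterval.nonneg' (t := t)) with rfl | ht
  · exact iff_of_true unitInterval.nonneg' unitInterval.nonneg'
  · exact h t ht

theorem minMem_mem_Delta {X : Type*} {L : Set (Set X)} {f : X → unitInterval}
    (hf : f ∈ DeltaXL X L) : (minMem f : L → unitInterval) ∈ Delta L := fun t ht =>
  ⟨⟨_, hf t ht⟩, Set.ext fun _ => le_minMem_iff⟩

theorem setOf_le_maxMem {X : Type*} [Finite X] {L : Set (Set X)} {F : L → unitInterval}
    {t : unitInterval} (ht : 0 < t) {G : L} (hG : {A | t ≤ F A} = Set.Iic G) :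
    {x | t ≤ maxMem F x} = G.1 := by
  ext x
  rw [Set.mem_ofPred_eq, le_maxMem_iff ht]
  constructor
  · rintro ⟨A, hx, h⟩
    have hA : A ∈ Set.Iic G := hG ▸ h
    exact hA hx
  · intro hx
    have hGG : G ∈ {A | t ≤ F A} := hG ▸ Set.mem_Iic.2 le_rfl
    exact ⟨G, hx, hGG⟩

theorem maxMem_mem_DeltaXL {X : Type*} [Finite X] {L : Set (Set X)} {F : L → unitInterval}
    (hF : F ∈ Delta L) : maxMem F ∈ DeltaXL X L := fun t ht => by
  obtain ⟨G, hG⟩ := hF t ht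
  rw [setOf_le_maxMem ht hG]
  exact G.2

theorem maxMem_minMem {X : Type*} [Finite X] {L : Set (Set X)} {f : X → unitInterval}
    (hf : f ∈ DeltaXL X L) : maxMem (minMem f : L → unitInterval) = f :=
  funext fun x => eq_of_forall_pos_le_iff fun t ht =>
    Set.ext_iff.1 (setOf_le_maxMem (F := (minMem f : L → unitInterval)) ht (G := ⟨_, hf t ht⟩)
      (Set.ext fun _ => le_minMem_iff)) x

theorem minMem_maxMem {X : Type*} [Finite X] {L : Set (Set X)} {F : L → unitInterval}
    (hF : F ∈ Delta L) : minMem (maxMem F) = F :=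
  funext fun A => eq_of_forall_pos_le_iff fun t ht => by
    obtain ⟨G, hG⟩ := hF t ht
    rw [le_minMem_iff, setOf_le_maxMem ht hG]
    exact (Set.ext_iff.1 hG A).symm

/-- The order isomorphism `Δ(X,L) ≃o Δ(L)` given by taking minima over members of `L`. -/
noncomputable def minMemOrderIso (X : Type*) [Finite X] (L : Set (Set X)) :
    DeltaXL X L ≃o Delta L where
  toFun f := ⟨minMem f.1, minMem_mem_Delta f.2⟩
  invFun F := ⟨maxMem F.1, maxMem_mem_DeltaXL F.2⟩
  left_inv f := Subtype.ext (maxMem_minMem f.2)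
  right_inv F := Subtype.ext (minMem_maxMem F.2)
  map_rel_iff' {f g} := by
    constructor
    · intro h
      change f.1 ≤ g.1
      rw [← maxMem_minMem f.2, ← maxMem_minMem g.2]
      exact fun x => iSup_mono fun A => h A.1
    · exact fun h A => iInf₂_mono fun x _ => h x

/-- For a nonempty finite lattice `P`, the set `Δ(P)` is closed under pointwise infima. -/
theorem exists_isGLB_Delta {P : Type*} [Lattice P] [Finite P] [Nonempty P]
    (S : Set (Delta P)) : ∃ F, IsGLB S F := by
  classical
  have := Fintype.ofFinite P
  have hglb : ∀ s : Set P, ∃ a, IsGLB s a := fun s => by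
    let := Fintype.toCompleteLatticeOfNonempty P
    exact ⟨sInf s, isGLB_sInf s⟩
  have hmem : (fun A => ⨅ F : S, F.1.1 A) ∈ Delta P := fun t ht => by
    choose G hG using fun F : S => F.1.2 t ht
    obtain ⟨a, ha⟩ := hglb (Set.range G)
    refine ⟨a, Set.ext fun A => ?_⟩
    rw [Set.mem_ofPred_eq, le_iInf_iff, Set.mem_Iic, le_isGLB_iff ha, mem_lowerBounds,
      Set.forall_mem_range]
    exact forall_congr' fun F => Set.ext_iff.1 (hG F) A
  exact ⟨⟨_, hmem⟩, fun F hF A => iInf_le (fun F : S => F.1.1 A) ⟨F, hF⟩,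
    fun K hK A => le_iInf fun F => hK F.2 A⟩

theorem exists_isGLB_DeltaXL {X : Type*} [Finite X] {L : Set (Set X)}
    (hsup : ∀ a ∈ L, ∀ b ∈ L, ∃ c ∈ L, a ∪ b ⊆ c ∧ ∀ d ∈ L, a ∪ b ⊆ d → c ⊆ d)
    (hinf : ∀ a ∈ L, ∀ b ∈ L, ∃ c ∈ L, c ⊆ a ∩ b ∧ ∀ d ∈ L, d ⊆ a ∩ b → d ⊆ c)
    (hL : L.Nonempty) (S : Set (DeltaXL X L)) : ∃ f, IsGLB S f := by
  choose! sup sup_mem le_sup sup_le using hsup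
  choose! inf inf_mem inf_le le_inf using hinf
  let : Lattice L :=
    { (inferInstance : PartialOrder L) with
      sup := fun a b => ⟨sup a.1 b.1, sup_mem _ a.2 _ b.2⟩
      le_sup_left := fun a b => Set.subset_union_left.trans (le_sup _ a.2 _ b.2)
      le_sup_right := fun a b => Set.subset_union_right.trans (le_sup _ a.2 _ b.2)
      sup_le := fun a b c hac hbc => sup_le _ a.2 _ b.2 _ c.2 (Set.union_subset hac hbc)
      inf := fun a b => ⟨inf a.1 b.1, inf_mem _ a.2 _ b.2⟩
      inf_le_left := fun a b => (inf_le _ a.2 _ b.2).trans Set.inter_subset_left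
      inf_le_right := fun a b => (inf_le _ a.2 _ b.2).trans Set.inter_subset_right
      le_inf := fun a b c hab hac => le_inf _ b.2 _ c.2 _ a.2 (Set.subset_inter hab hac) }
  have := hL.to_subtype
  obtain ⟨F, hF⟩ := exists_isGLB_Delta (minMemOrderIso X L '' S)
  exact ⟨(minMemOrderIso X L).symm F, (minMemOrderIso X L).isGLB_image.1 hF⟩

/-- Let `X` be a finite set and `L` a family of subsets of `X` forming a lattice under
inclusion (every pair has a least upper bound and a greatest lower bound in `L`).
Then the map sending `f ∈ Δ(X,L)` to the function `F : L → [0,1]` with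
`F A = min_{x ∈ A} f x` for nonempty `A` and `F ∅ = 1` is an order isomorphism of
`Δ(X,L)` onto `Δ(L)`; in particular `Δ(X,L)` has pairwise greatest lower bounds and
least upper bounds for the pointwise order. -/
theorem stmt5 {X : Type*} [Fintype X] (L : Set (Set X))
    (hsup : ∀ a ∈ L, ∀ b ∈ L, ∃ c ∈ L, a ∪ b ⊆ c ∧ ∀ d ∈ L, a ∪ b ⊆ d → c ⊆ d)
    (hinf : ∀ a ∈ L, ∀ b ∈ L, ∃ c ∈ L, c ⊆ a ∩ b ∧ ∀ d ∈ L, d ⊆ a ∩ b → d ⊆ c) :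
    (∃ φ : ↥(DeltaXL X L) ≃o ↥(Delta ↥L),
      ∀ (f : ↥(DeltaXL X L)) (A : ↥L),
        (A.1.Nonempty → IsGLB (f.1 '' A.1) ((φ f).1 A)) ∧
        (A.1 = ∅ → (φ f).1 A = 1)) ∧
    (∀ f g : X → unitInterval, f ∈ DeltaXL X L → g ∈ DeltaXL X L →
      (∃ m ∈ DeltaXL X L, m ≤ f ∧ m ≤ g ∧
        ∀ k ∈ DeltaXL X L, k ≤ f → k ≤ g → k ≤ m) ∧
      (∃ j ∈ DeltaXL X L, f ≤ j ∧ g ≤ j ∧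
        ∀ k ∈ DeltaXL X L, f ≤ k → g ≤ k → j ≤ k)) := by
  refine ⟨⟨minMemOrderIso X L, fun f A => ⟨fun _ => isGLB_biInf, fun hA => ?_⟩⟩,
    fun f g hf hg => ?_⟩
  · change ⨅ x ∈ A.1, f.1 x = ⊤
    simp [hA]
  · have hglb := exists_isGLB_DeltaXL hsup hinf ⟨_, hf 1 zero_lt_one⟩
    let f' : DeltaXL X L := ⟨f, hf⟩
    let g' : DeltaXL X L := ⟨g, hg⟩
    obtain ⟨m, hm⟩ := hglb {f', g'}
    obtain ⟨j, hj⟩ := hglb (upperBounds {f', g'})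
    rw [isGLB_upperBounds] at hj
    refine ⟨⟨m.1, m.2, hm.1 (Or.inl rfl), hm.1 (Or.inr rfl), fun k hk hkf hkg => ?_⟩,
      ⟨j.1, j.2, hj.1 (Or.inl rfl), hj.1 (Or.inr rfl), fun k hk hfk hgk => ?_⟩⟩
    · have hkl : (⟨k, hk⟩ : DeltaXL X L) ∈ lowerBounds {f', g'} := by
        rintro _ (rfl | rfl)
        exacts [hkf, hkg]
      exact hm.2 hkl
    · have hku : (⟨k, hk⟩ : DeltaXL X L) ∈ upperBounds {f', g'} := by
        rintro _ (rfl | rfl)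
        exacts [hfk, hgk]
      exact hj.2 hku
end

section
/- Let L be a finite (nonempty) lattice. Then the breadth of the lattice Δ(L) equals the supremum of the lengths of chains in L, where the length of a finite chain is one less than its number of elements. (Equivalently, br(Δ(L)) equals the dimension of the simplicial complex Δ(L).) -/
/-- A finite nonempty subset `S` of a poset is meet-irredundant if the greatest lower
bound of `S` differs from the greatest lower bound of every proper subset of `S`
(the meet of the empty set being a greatest element, as expressed by `IsGLB ∅`). -/
def MeetIrredundant {α : Type*} [PartialOrder α] (S : Finset α) : Prop :=
  S.Nonempty ∧
    ∀ m m' : α, IsGLB (S : Set α) m →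
      ∀ S' : Finset α, S' ⊂ S → IsGLB (S' : Set α) m' → m ≠ m'

theorem Delta.map_bot {L : Type*} [Lattice L] [OrderBot L] {f : L → unitInterval}
    (hf : f ∈ Delta L) : f ⊥ = ⊤ := by
  obtain ⟨x, hx⟩ := hf ⊤ (lt_of_lt_of_le zero_lt_one le_top)
  exact top_le_iff.mp (hx.symm ▸ bot_le : (⊥ : L) ∈ {y | ⊤ ≤ f y})

theorem Delta.antitone {L : Type*} [Lattice L] {f : L → unitInterval}
    (hf : f ∈ Delta L) : Antitone f := by
  intro a b hab
  rcases eq_or_lt_of_le (unitInterval.nonneg' : 0 ≤ f b) with h | h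
  · exact h ▸ unitInterval.nonneg'
  · obtain ⟨x, hx⟩ := hf _ h
    have hb : b ≤ x := (hx ▸ le_refl (f b) : b ∈ Set.Iic x)
    exact (hx.symm ▸ hab.trans hb : a ∈ {y | f b ≤ f y})

theorem Delta.map_sup {L : Type*} [Lattice L] {f : L → unitInterval}
    (hf : f ∈ Delta L) (a b : L) : f (a ⊔ b) = f a ⊓ f b := by
  apply le_antisymm
  · exact le_inf (Delta.antitone hf le_sup_left) (Delta.antitone hf le_sup_right)
  · rcases eq_or_lt_of_le (unitInterval.nonneg' : 0 ≤ f a ⊓ f b) with h | h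
    · exact h ▸ unitInterval.nonneg'
    · obtain ⟨x, hx⟩ := hf _ h
      have ha : a ∈ Set.Iic x := hx ▸ (inf_le_left : f a ⊓ f b ≤ f a)
      have hb : b ∈ Set.Iic x := hx ▸ (inf_le_right : f a ⊓ f b ≤ f b)
      exact (hx.symm ▸ sup_le ha hb : a ⊔ b ∈ {y | f a ⊓ f b ≤ f y})

theorem Finset.map_sup_eq_inf {α β ι : Type*} [SemilatticeSup α] [OrderBot α]
    [SemilatticeInf β] [OrderTop β] {f : α → β} (bot : f ⊥ = ⊤)
    (sup : ∀ a b, f (a ⊔ b) = f a ⊓ f b) (s : Finset ι) (x : ι → α) :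
    f (s.sup x) = s.inf fun i => f (x i) := by
  classical
  induction s using Finset.induction_on with
  | empty => simpa using bot
  | insert a s _ ih => rw [Finset.sup_insert, Finset.inf_insert, sup, ih]

theorem Delta.mem_of_map_sup {L : Type*} [Fintype L] [Lattice L] [OrderBot L]
    {f : L → unitInterval} (bot : f ⊥ = ⊤) (sup : ∀ a b, f (a ⊔ b) = f a ⊓ f b) :
    f ∈ Delta L := by
  classical
  intro t _
  refine ⟨(Finset.univ.filter fun y => t ≤ f y).sup id,
    Set.ext fun y => ⟨fun hy => ?_, fun hy => ?_⟩⟩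
  · exact Finset.le_sup (f := id) (by simpa using hy)
  · have hsup : t ≤ f ((Finset.univ.filter fun y => t ≤ f y).sup id) := by
      rw [Finset.map_sup_eq_inf bot sup]
      exact Finset.le_inf fun z hz => (Finset.mem_filter.mp hz).2
    refine hsup.trans ?_
    rw [← sup_eq_right.mpr hy, sup]
    exact inf_le_left

/-- The pointwise meet of a finite family in `Δ(L)`. -/
def Delta.finsetInf {L : Type*} [Fintype L] [Lattice L] [OrderBot L]
    (T : Finset (Delta L)) : Delta L :=
  ⟨fun x => T.inf fun f => f.1 x, Delta.mem_of_map_sup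
    (top_le_iff.mp (Finset.le_inf fun f _ => (Delta.map_bot f.2).ge))
    fun a b => by
      simp only [Delta.map_sup (Subtype.prop _)]
      exact Finset.inf_inf⟩

theorem Delta.isGLB_finsetInf {L : Type*} [Fintype L] [Lattice L] [OrderBot L]
    (T : Finset (Delta L)) : IsGLB (T : Set (Delta L)) (Delta.finsetInf T) :=
  ⟨fun _ hf x => Finset.inf_le (f := fun f : Delta L => f.1 x) hf,
    fun _ hm x => Finset.le_inf fun _ hf => hm hf x⟩

theorem Delta.meetIrredundant_iff {L : Type*} [Fintype L] [Lattice L] [OrderBot L]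
    (S : Finset (Delta L)) : MeetIrredundant S ↔ S.Nonempty ∧
      ∀ f ∈ S, ∃ x, f.1 x < ⊤ ∧ ∀ g ∈ S, g ≠ f → f.1 x < g.1 x := by
  classical
  refine and_congr_right fun _ => ⟨fun h f hf => ?_, fun h m m' hm S' hS' hm' heq => ?_⟩
  · by_contra! hcon
    refine h _ _ (isGLB_finsetInf S) _ (Finset.erase_ssubset hf)
      (isGLB_finsetInf (S.erase f)) (le_antisymm ?_ ?_)
    · exact (isGLB_finsetInf _).mono (isGLB_finsetInf S) (by simp)
    · refine (isGLB_finsetInf S).2 fun g hg => ?_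
      by_cases hgf : g = f
      · subst hgf
        intro x
        by_contra! hlt
        obtain ⟨k, hkS, hkg, hk⟩ := hcon x (hlt.trans_le le_top)
        exact (hlt.trans_le ((isGLB_finsetInf (S.erase g)).1
          (Finset.mem_coe.mpr (Finset.mem_erase.mpr ⟨hkg, hkS⟩)) x)).not_ge hk
      · exact (isGLB_finsetInf _).1 (Finset.mem_coe.mpr (Finset.mem_erase.mpr ⟨hgf, hg⟩))
  · obtain ⟨f, hf, hfS'⟩ := Finset.exists_of_ssubset hS'
    obtain ⟨x, hx, hlt⟩ := h f hf
    have hmf : m.1 x ≤ f.1 x := hm.1 hf x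
    rw [heq, hm'.unique (isGLB_finsetInf S')] at hmf
    refine hmf.not_gt ((Finset.lt_inf_iff hx).mpr fun g hg => hlt g (hS'.1 hg) ?_)
    rintro rfl
    exact hfS' hg

theorem MeetIrredundant.exists_isChain {L : Type*} [Fintype L] [Lattice L] [OrderBot L]
    {S : Finset (Delta L)} (hS : MeetIrredundant S) :
    ∃ C : Finset L, IsChain (· ≤ ·) (C : Set L) ∧ C.card = S.card + 1 := by
  classical
  have hwit : ∀ f : Delta L, ∃ x, f ∈ S → f.1 x < ⊤ ∧ ∀ g ∈ S, g ≠ f → f.1 x < g.1 x := by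
    intro f
    by_cases hf : f ∈ S
    · obtain ⟨x, hx⟩ := ((Delta.meetIrredundant_iff S).mp hS).2 f hf
      exact ⟨x, fun _ => hx⟩
    · exact ⟨⊥, fun h => (hf h).elim⟩
  choose x hx using hwit
  suffices h : ∀ T : Finset (Delta L), T ⊆ S → ∃ C : Finset L,
      IsChain (· ≤ ·) (C : Set L) ∧ C.card = T.card + 1 ∧ ∀ c ∈ C, c ≤ T.sup x by
    obtain ⟨C, hC, hcard, -⟩ := h S subset_rfl
    exact ⟨C, hC, hcard⟩
  intro T
  induction T using Finset.induction_on_min_value (f := fun f : Delta L => f.1 (x f)) with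
  | empty => exact fun _ => ⟨{⊥}, by simp, by simp, by simp⟩
  | insert f T hfT hmin ih =>
    intro hsub
    obtain ⟨hfS, hTS⟩ := Finset.insert_subset_iff.mp hsub
    obtain ⟨C, hC, hcard, hle⟩ := ih hTS
    have hlt : f.1 (x f) < f.1 (T.sup x) := by
      rw [Finset.map_sup_eq_inf (Delta.map_bot f.2) (Delta.map_sup f.2),
        Finset.lt_inf_iff (hx f hfS).1]
      intro g hg
      exact (hmin g hg).trans_lt ((hx g (hTS hg)).2 f hfS fun h => hfT (h ▸ hg))
    have hnle : ¬ x f ⊔ T.sup x ≤ T.sup x := fun h =>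
      (hlt.trans_le (Delta.antitone f.2 (le_sup_left.trans h))).false
    refine ⟨insert (x f ⊔ T.sup x) C, ?_, ?_, ?_⟩
    · rw [Finset.coe_insert]
      exact hC.insert fun c hc _ => Or.inr ((hle c hc).trans le_sup_right)
    · rw [Finset.card_insert_of_notMem fun h => hnle (hle _ h), hcard,
        Finset.card_insert_of_notMem hfT]
    · rw [Finset.sup_insert]
      intro c hc
      rcases Finset.mem_insert.mp hc with rfl | hc
      · exact le_rfl
      · exact (hle c hc).trans le_sup_right

open Classical in
/-- The element of `Δ(L)` equal to `1` on the ideal `↓c` and to `s` elsewhere. -/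
noncomputable def Delta.step {L : Type*} [Fintype L] [Lattice L] [OrderBot L]
    (c : L) (s : unitInterval) : Delta L :=
  ⟨fun y => if y ≤ c then ⊤ else s, Delta.mem_of_map_sup (by simp) fun a b => by
    by_cases ha : a ≤ c <;> by_cases hb : b ≤ c <;> simp [ha, hb]⟩

theorem Delta.step_of_le {L : Type*} [Fintype L] [Lattice L] [OrderBot L]
    {c y : L} (s : unitInterval) (h : y ≤ c) : (Delta.step c s).1 y = ⊤ :=
  if_pos h

theorem Delta.step_of_not_le {L : Type*} [Fintype L] [Lattice L] [OrderBot L]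
    {c y : L} (s : unitInterval) (h : ¬ y ≤ c) : (Delta.step c s).1 y = s :=
  if_neg h

theorem IsChain.exists_strictMono_fin {α : Type*} [PartialOrder α] {C : Finset α} {n : ℕ}
    (hC : IsChain (· ≤ ·) (C : Set α)) (hn : C.card = n) : ∃ c : Fin n → α, StrictMono c := by
  classical
  let _ := hC.linearOrder
  exact ⟨fun i => (monoEquivOfFin (C : Set α) (by simpa using hn) i).1,
    fun i j h => (monoEquivOfFin (C : Set α) (by simpa using hn)).strictMono h⟩

theorem Delta.exists_meetIrredundant {L : Type*} [Fintype L] [Lattice L] [OrderBot L]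
    {n : ℕ} (hn : n ≠ 0) {c : Fin (n + 1) → L} (hc : StrictMono c) :
    ∃ S : Finset (Delta L), MeetIrredundant S ∧ S.card = n := by
  classical
  obtain ⟨s, hs, hs_top⟩ : ∃ s : Fin n → unitInterval, StrictAnti s ∧ ∀ i, s i < ⊤ := by
    refine ⟨fun i => ⟨1 / ((i : ℝ) + 2), by positivity, ?_⟩, fun i j hij => ?_, fun i => ?_⟩
    · rw [div_le_one (by positivity)]
      linarith [(Nat.cast_nonneg (i : ℕ) : (0 : ℝ) ≤ (i : ℕ))]
    · have : ((i : ℕ) : ℝ) < (j : ℕ) := by exact_mod_cast hij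
      exact Subtype.mk_lt_mk.mpr (one_div_lt_one_div_of_lt (by positivity) (by linarith))
    · refine Subtype.mk_lt_mk.mpr ((div_lt_one (by positivity)).mpr ?_)
      linarith [(Nat.cast_nonneg (i : ℕ) : (0 : ℝ) ≤ (i : ℕ))]
  let F : Fin n → Delta L := fun i => Delta.step (c i.castSucc) (s i)
  have hself : ∀ i, (F i).1 (c i.succ) = s i := fun i =>
    Delta.step_of_not_le _ (hc i.castSucc_lt_succ).not_ge
  have hlt : ∀ i j, j ≠ i → (F i).1 (c i.succ) < (F j).1 (c i.succ) := by
    intro i j hji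
    rw [hself]
    rcases lt_or_gt_of_ne hji with h | h
    · have : (F j).1 (c i.succ) = s j := Delta.step_of_not_le _
        (hc ((Fin.castSucc_lt_castSucc_iff.mpr h).trans i.castSucc_lt_succ)).not_ge
      exact this ▸ hs h
    · have : (F j).1 (c i.succ) = ⊤ := Delta.step_of_le _
        (hc.monotone (Fin.succ_le_castSucc_iff.mpr h))
      exact this ▸ hs_top i
  have hinj : Function.Injective F := fun i j hij => by
    by_contra hne
    exact (hlt i j (Ne.symm hne)).ne (by rw [hij])
  refine ⟨Finset.univ.image F, (Delta.meetIrredundant_iff _).mpr ⟨?_, ?_⟩, ?_⟩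
  · exact ⟨F ⟨0, Nat.pos_of_ne_zero hn⟩, by simp⟩
  · simp only [Finset.mem_image, Finset.mem_univ, true_and, forall_exists_index,
      forall_apply_eq_imp_iff]
    exact fun i => ⟨c i.succ, (hself i).trans_lt (hs_top i),
      fun j hji => hlt i j fun h => hji (h ▸ rfl)⟩
  · rw [Finset.card_image_of_injective _ hinj, Finset.card_univ, Fintype.card_fin]

/-- For a finite nonempty lattice `L`, the breadth of the lattice `Δ(L)` (the supremum
of the cardinalities of its meet-irredundant finite subsets) equals the supremum of the
lengths of chains in `L`, a chain of `n + 1` elements having length `n`. -/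
theorem stmt6 {L : Type*} [Fintype L] [Lattice L] [Nonempty L] :
    sSup {n : ℕ | ∃ S : Finset ↥(Delta L), MeetIrredundant S ∧ S.card = n} =
      sSup {n : ℕ | ∃ C : Finset L, IsChain (· ≤ ·) (C : Set L) ∧ C.card = n + 1} := by
  let _ : OrderBot L := Fintype.toOrderBot L
  have hsub : {n : ℕ | ∃ S : Finset ↥(Delta L), MeetIrredundant S ∧ S.card = n} ⊆
      {n : ℕ | ∃ C : Finset L, IsChain (· ≤ ·) (C : Set L) ∧ C.card = n + 1} := by
    rintro _ ⟨S, hS, rfl⟩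
    exact hS.exists_isChain
  have hbdd : BddAbove
      {n : ℕ | ∃ C : Finset L, IsChain (· ≤ ·) (C : Set L) ∧ C.card = n + 1} := by
    refine ⟨Fintype.card L, ?_⟩
    rintro n ⟨C, -, hcard⟩
    have := C.card_le_univ
    omega
  refine le_antisymm (csSup_le' fun n hn => le_csSup hbdd (hsub hn)) (csSup_le' ?_)
  rintro n ⟨C, hC, hcard⟩
  rcases eq_or_ne n 0 with rfl | hn
  · exact Nat.zero_le _
  · obtain ⟨c, hc⟩ := hC.exists_strictMono_fin hcard
    exact le_csSup (hbdd.mono hsub) (Delta.exists_meetIrredundant hn hc)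
end

section
/- Let P be a finite partially ordered set and S ⊆ P × P a set of pairs (x,y) each satisfying x ≤ y. Let Δ(P,S) be the set of f ∈ Δ(P) such that for all (x,y) ∈ S, if f(x) < 1 then f(y) = 0. Then: (i) for every x ∈ P the characteristic function of ↓x belongs to Δ(P,S); (ii) if P has greatest lower bounds of pairs, then for f, g ∈ Δ(P,S) the pointwise infimum f ∧ g lies in Δ(P,S); (iii) if P has least upper bounds of pairs and every second coordinate y of a pair (x,y) ∈ S is join-prime (meaning w ∨ z ≥ y implies w ≥ y or z ≥ y), then for f, g ∈ Δ(P,S) the least upper bound f ∨ g of f and g in Δ(P) lies in Δ(P,S). In particular, if P is a finite lattice and all second coordinates of members of S are join-prime, then Δ(P,S) is a sublattice of Δ(P) containing all characteristic functions ↓x. -/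
/-- `DeltaS P S` is the set of `f ∈ Δ(P)` such that for all `(x,y) ∈ S`, if `f x < 1`
then `f y = 0`. -/
def DeltaS (P : Type*) [PartialOrder P] (S : Set (P × P)) : Set (P → unitInterval) :=
  {f | f ∈ Delta P ∧ ∀ p ∈ S, f p.1 < 1 → f p.2 = 0}

/-- The characteristic function of a principal ideal lies in `Delta P`. -/
lemma indicator_Iic_mem_Delta {P : Type*} [PartialOrder P] (x : P) :
    (fun y => Set.indicator (Set.Iic x) (fun _ => (1 : unitInterval)) y) ∈ Delta P := by
  intro t ht
  refine ⟨x, Set.ext fun y => ?_⟩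
  by_cases hy : y ≤ x
  · simp [hy, unitInterval.le_one']
  · simp [hy, ht.ne']

/-- The support of a member of `Delta P` is a principal ideal when `P` is finite. -/
lemma exists_pos_iff_le_of_mem_Delta {P : Type*} [Fintype P] [PartialOrder P]
    {f : P → unitInterval} (hf : f ∈ Delta P) : ∃ a : P, ∀ y, 0 < f y ↔ y ≤ a := by
  classical
  let t : unitInterval := Finset.univ.inf fun p => if f p = 0 then 1 else f p
  have ht : 0 < t := by
    refine (Finset.lt_inf_iff (show (0 : unitInterval) < ⊤ from zero_lt_one)).2 fun p _ => ?_
    split_ifs with h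
    · exact zero_lt_one
    · exact unitInterval.pos_iff_ne_zero.2 h
  obtain ⟨a, ha⟩ := hf t ht
  refine ⟨a, fun y => ?_⟩
  rw [← Set.mem_Iic, ← ha, Set.mem_ofPred_eq]
  refine ⟨fun hy => ?_, ht.trans_le⟩
  simpa [hy.ne'] using
    Finset.inf_le (f := fun p => if f p = 0 then 1 else f p) (Finset.mem_univ y)

/-- A function whose support lies in `↓x` is below the characteristic function of `↓x`. -/
lemma le_indicator_Iic {P : Type*} [PartialOrder P] {f : P → unitInterval} {x : P}
    (h : ∀ y, 0 < f y → y ≤ x) :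
    f ≤ fun y => Set.indicator (Set.Iic x) (fun _ => (1 : unitInterval)) y := by
  intro y
  by_cases hy : y ≤ x
  · simp [hy, unitInterval.le_one']
  · have : f y = 0 := by
      by_contra h0
      exact hy (h y (unitInterval.pos_iff_ne_zero.2 h0))
    simp [this]

/-- Let `P` be a finite poset and `S ⊆ P × P` a set of pairs `(x,y)` with `x ≤ y`.
Then: (i) every characteristic function of a principal ideal `↓x` lies in `Δ(P,S)`;
(ii) if `P` has greatest lower bounds of pairs, then `Δ(P,S)` is closed under pointwise
infima; (iii) if `P` has least upper bounds of pairs and every second coordinate of a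
member of `S` is join-prime, then the least upper bound in `Δ(P)` of two members of
`Δ(P,S)` again lies in `Δ(P,S)`. -/
theorem stmt7 {P : Type*} [Fintype P] [PartialOrder P] (S : Set (P × P))
    (hS : ∀ p ∈ S, p.1 ≤ p.2) :
    (∀ x : P,
      (fun y => Set.indicator (Set.Iic x) (fun _ => (1 : unitInterval)) y) ∈ DeltaS P S) ∧
    ((∀ a b : P, ∃ m, IsGLB {a, b} m) →
      ∀ f g : P → unitInterval, f ∈ DeltaS P S → g ∈ DeltaS P S →
        (fun x => min (f x) (g x)) ∈ DeltaS P S) ∧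
    ((∀ a b : P, ∃ s, IsLUB {a, b} s) →
      (∀ p ∈ S, ∀ w z s : P, IsLUB {w, z} s → p.2 ≤ s → p.2 ≤ w ∨ p.2 ≤ z) →
      ∀ f g j : P → unitInterval, f ∈ DeltaS P S → g ∈ DeltaS P S → j ∈ Delta P →
        f ≤ j → g ≤ j → (∀ k ∈ Delta P, f ≤ k → g ≤ k → j ≤ k) →
        j ∈ DeltaS P S) := by
  refine ⟨fun x => ⟨indicator_Iic_mem_Delta x, fun p hp h => ?_⟩,
    fun hglb f g hf hg => ⟨fun t ht => ?_, fun p hp h => ?_⟩,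
    fun hlub hprime f g j hf hg hj hfj hgj hmin => ⟨hj, fun p hp h => ?_⟩⟩
  · have h1 : ¬ p.1 ≤ x := fun h1 => by simp [h1] at h
    have h2 : ¬ p.2 ≤ x := fun h2 => h1 ((hS p hp).trans h2)
    simp [h2]
  · obtain ⟨a, ha⟩ := hf.1 t ht
    obtain ⟨b, hb⟩ := hg.1 t ht
    obtain ⟨m, hm⟩ := hglb a b
    refine ⟨m, Set.ext fun y => ?_⟩
    have hya : t ≤ f y ↔ y ≤ a := Set.ext_iff.1 ha y
    have hyb : t ≤ g y ↔ y ≤ b := Set.ext_iff.1 hb y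
    simp [hya, hyb, le_isGLB_iff hm]
  · rcases min_lt_iff.1 h with h | h
    · simp [hf.2 p hp h]
    · simp [hg.2 p hp h]
  · have hf0 : f p.2 = 0 := hf.2 p hp ((hfj p.1).trans_lt h)
    have hg0 : g p.2 = 0 := hg.2 p hp ((hgj p.1).trans_lt h)
    obtain ⟨a, ha⟩ := exists_pos_iff_le_of_mem_Delta hf.1
    obtain ⟨b, hb⟩ := exists_pos_iff_le_of_mem_Delta hg.1
    obtain ⟨s, hs⟩ := hlub a b
    have has : a ≤ s := hs.1 (by simp)
    have hbs : b ≤ s := hs.1 (by simp)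
    have hps : ¬ p.2 ≤ s := fun hle => by
      rcases hprime p hp a b s hs hle with h' | h'
      · exact ((ha p.2).2 h').ne' hf0
      · exact ((hb p.2).2 h').ne' hg0
    have hle := hmin _ (indicator_Iic_mem_Delta s)
      (le_indicator_Iic fun y hy => ((ha y).1 hy).trans has)
      (le_indicator_Iic fun y hy => ((hb y).1 hy).trans hbs) p.2
    exact le_antisymm (by simpa [hps] using hle) unitInterval.nonneg'
end

section
/- Let L be a topological lattice (a Hausdorff topological space with a lattice structure whose binary meet and join are continuous) whose underlying space is connected, and suppose p ∈ L is a point such that L \ {p} is disconnected. Then L \ {p} has precisely two connected components, namely (↓p) \ {p} and (↑p) \ {p}, where ↓p = {x ∈ L | x ≤ p} and ↑p = {x ∈ L | x ≥ p}. In particular, every element of L is comparable with p. -/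
theorem isPreconnected_Iic_of_continuousInf {L : Type*} [TopologicalSpace L]
    [SemilatticeInf L] [ContinuousInf L] [PreconnectedSpace L] (a : L) :
    IsPreconnected (Set.Iic a) := by
  have h : Set.range (fun x : L => x ⊓ a) = Set.Iic a := by
    ext y
    exact ⟨by rintro ⟨x, rfl⟩; exact inf_le_right, fun hy => ⟨y, inf_eq_left.2 hy⟩⟩
  exact h ▸ isPreconnected_range (continuous_id.inf continuous_const)

/-- In a connected topological meet-semilattice every lower set is connected, being a union of
pairwise intersecting principal lower sets. -/
theorem IsLowerSet.isPreconnected {L : Type*} [TopologicalSpace L] [SemilatticeInf L]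
    [ContinuousInf L] [PreconnectedSpace L] {s : Set L} (hs : IsLowerSet s) :
    IsPreconnected s := by
  refine isPreconnected_of_forall_pair fun x hx y hy =>
    ⟨Set.Iic x ∪ Set.Iic y, Set.union_subset (hs.Iic_subset hx) (hs.Iic_subset hy),
      Or.inl le_rfl, Or.inr le_rfl, ?_⟩
  exact (isPreconnected_Iic_of_continuousInf x).union (x ⊓ y) inf_le_left inf_le_right
    (isPreconnected_Iic_of_continuousInf y)

theorem IsUpperSet.isPreconnected {L : Type*} [TopologicalSpace L] [SemilatticeSup L]
    [ContinuousSup L] [PreconnectedSpace L] {s : Set L} (hs : IsUpperSet s) :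
    IsPreconnected s :=
  haveI : PreconnectedSpace Lᵒᵈ := ‹PreconnectedSpace L›
  hs.toDual.isPreconnected

/-- If a set that is not preconnected is the union of two preconnected sets, then each nonempty one
of them is a connected component. -/
theorem connectedComponentIn_eq_of_union_eq {X : Type*} [TopologicalSpace X] {s t u : Set X}
    (hs : IsPreconnected s) (ht : IsPreconnected t) (hu : s ∪ t = u) (hnot : ¬ IsPreconnected u)
    {x : X} (hx : x ∈ s) : connectedComponentIn u x = s := by
  have hsub : s ⊆ connectedComponentIn u x :=
    hs.subset_connectedComponentIn hx (hu ▸ Set.subset_union_left)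
  refine Set.Subset.antisymm (fun y hy => ?_) hsub
  rcases hu.symm ▸ connectedComponentIn_subset u x hy with h | hyt
  · exact h
  · refine absurd ?_ hnot
    have h := isPreconnected_connectedComponentIn.union y hy hyt ht
    have he : connectedComponentIn u x ∪ t = u :=
      Set.Subset.antisymm
        (Set.union_subset (connectedComponentIn_subset u x) (hu ▸ Set.subset_union_right))
        (hu ▸ Set.union_subset_union_left t (hu.symm ▸ hsub))
    exact he ▸ h

/-- Let `L` be a topological lattice (Hausdorff, with continuous binary meet and join)
whose underlying space is connected, and let `p ∈ L` be a point such that `L \ {p}` is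
disconnected.  Then `L \ {p}` has precisely two connected components, namely
`(↓p) \ {p}` and `(↑p) \ {p}`; in particular every element of `L` is comparable
with `p`. -/
theorem stmt8 {L : Type*} [TopologicalSpace L] [T2Space L] [Lattice L]
    [TopologicalLattice L] [ConnectedSpace L] (p : L)
    (hdisc : ¬ IsPreconnected ({p}ᶜ : Set L)) :
    (∀ x : L, x ≤ p ∨ p ≤ x) ∧
    IsPreconnected (Set.Iic p \ {p}) ∧
    IsPreconnected (Set.Ici p \ {p}) ∧
    (Set.Iic p \ {p}).Nonempty ∧
    (Set.Ici p \ {p}).Nonempty ∧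
    (Set.Iic p \ {p}) ∪ (Set.Ici p \ {p}) = ({p}ᶜ : Set L) ∧
    Disjoint (Set.Iic p \ {p}) (Set.Ici p \ {p}) ∧
    (∀ x ∈ ({p}ᶜ : Set L),
      connectedComponentIn ({p}ᶜ : Set L) x = Set.Iic p \ {p} ∨
      connectedComponentIn ({p}ᶜ : Set L) x = Set.Ici p \ {p}) := by
  have hlow : IsPreconnected {x : L | ¬ p ≤ x} :=
    IsLowerSet.isPreconnected fun _ _ hba ha hb => ha (hb.trans hba)
  have hupp : IsPreconnected {x : L | ¬ x ≤ p} :=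
    IsUpperSet.isPreconnected fun _ _ hab ha hb => ha (hab.trans hb)
  have hunion : {x : L | ¬ p ≤ x} ∪ {x : L | ¬ x ≤ p} = ({p}ᶜ : Set L) := by
    ext x
    simp only [Set.mem_union, Set.mem_ofPred_eq, Set.mem_compl_iff, Set.mem_singleton_iff,
      ← not_and_or, le_antisymm_iff, and_comm]
  have hcomp : ∀ x : L, x ≤ p ∨ p ≤ x := by
    intro x
    by_contra! hx
    exact hdisc (hunion ▸ hlow.union x hx.2 hx.1 hupp)
  have hIic : {x : L | ¬ p ≤ x} = Set.Iic p \ {p} := by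
    ext x
    exact ⟨fun h => ⟨(hcomp x).resolve_right h, fun he => h he.ge⟩,
      fun h hp => h.2 (le_antisymm h.1 hp)⟩
  have hIci : {x : L | ¬ x ≤ p} = Set.Ici p \ {p} := by
    ext x
    exact ⟨fun h => ⟨(hcomp x).resolve_left h, fun he => h he.le⟩,
      fun h hp => h.2 (le_antisymm hp h.1)⟩
  rw [hIic] at hlow hunion
  rw [hIci] at hupp hunion
  refine ⟨hcomp, hlow, hupp, ?_, ?_, hunion, ?_, fun x hx => ?_⟩
  · rw [Set.nonempty_iff_ne_empty]
    intro h
    rw [h, Set.empty_union] at hunion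
    exact hdisc (hunion ▸ hupp)
  · rw [Set.nonempty_iff_ne_empty]
    intro h
    rw [h, Set.union_empty] at hunion
    exact hdisc (hunion ▸ hlow)
  · exact Set.disjoint_left.2 fun x hx hx' => hx.2 (le_antisymm hx.1 hx'.1)
  · rcases hunion.symm ▸ hx with h | h
    · exact Or.inl (connectedComponentIn_eq_of_union_eq hlow hupp hunion hdisc h)
    · exact Or.inr (connectedComponentIn_eq_of_union_eq hupp hlow
        (Set.union_comm _ _ ▸ hunion) hdisc h)
end

section
/- Let L be a compact topological lattice (a compact Hausdorff topological space with a lattice structure whose binary meet and join are continuous) and let x ∈ L. Then the following conditions are equivalent: (i) every neighborhood U of x contains a neighborhood V of x which is a sublattice of L (closed under meet and join); (ii) every neighborhood U of x contains a neighborhood V of x which is an interval [y,z] = {w ∈ L | y ≤ w ≤ z} for some y ≤ z in L. -/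
theorem orderClosedTopology_of_continuousInf {L : Type*} [TopologicalSpace L] [T2Space L]
    [SemilatticeInf L] [ContinuousInf L] : OrderClosedTopology L where
  isClosed_le' := by
    simp_rw [← inf_eq_left]
    exact isClosed_eq (continuous_fst.inf continuous_snd) continuous_fst

/-- A nonempty compact set which is closed under binary meets has a least element. -/
theorem IsCompact.exists_isLeast_of_infClosed {L : Type*} [TopologicalSpace L]
    [SemilatticeInf L] [ClosedIicTopology L] {K : Set L} (hK : IsCompact K)
    (hne : K.Nonempty) (hinf : InfClosed K) : ∃ y, IsLeast K y := by
  obtain ⟨y, hyK, hy⟩ := hK.inter_iInter_nonempty (fun a : K => Set.Iic (a : L))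
    (fun a => isClosed_Iic) (fun t => by
      obtain rfl | ht := t.eq_empty_or_nonempty
      · simpa using hne
      · exact ⟨t.inf' ht (fun a => (a : L)), hinf.finsetInf'_mem ht fun a _ => a.2,
          Set.mem_iInter₂.2 fun a ha => Finset.inf'_le _ ha⟩)
  exact ⟨y, hyK, fun a ha => Set.mem_iInter.1 hy ⟨a, ha⟩⟩

/-- A nonempty compact set which is closed under binary joins has a greatest element. -/
theorem IsCompact.exists_isGreatest_of_supClosed {L : Type*} [TopologicalSpace L]
    [SemilatticeSup L] [ClosedIciTopology L] {K : Set L} (hK : IsCompact K)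
    (hne : K.Nonempty) (hsup : SupClosed K) : ∃ z, IsGreatest K z :=
  IsCompact.exists_isLeast_of_infClosed (L := Lᵒᵈ) hK hne hsup

/-- In a compact ordered space, order intervals with endpoints close to `x` are close to `x`. -/
theorem exists_mem_nhds_forall_Icc_subset {L : Type*} [TopologicalSpace L] [CompactSpace L]
    [PartialOrder L] [OrderClosedTopology L] {x : L} {U : Set L} (hU : U ∈ nhds x) :
    ∃ N ∈ nhds x, ∀ a ∈ N, ∀ b ∈ N, Set.Icc a b ⊆ U := by
  have hclosed : IsClosed {p : (L × L) × L | p.2 ∉ interior U ∧ p.1.1 ≤ p.2 ∧ p.2 ≤ p.1.2} :=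
    (isOpen_interior.isClosed_compl.preimage continuous_snd).inter
      ((isClosed_le (by fun_prop) (by fun_prop)).inter
        (isClosed_le (by fun_prop) (by fun_prop)))
  have himage := isClosedMap_fst_of_compactSpace _ hclosed
  have hx : (x, x) ∉ Prod.fst ''
      {p : (L × L) × L | p.2 ∉ interior U ∧ p.1.1 ≤ p.2 ∧ p.2 ≤ p.1.2} := by
    rintro ⟨⟨⟨a, b⟩, c⟩, ⟨hc, hac, hcb⟩, h⟩
    obtain ⟨rfl, rfl⟩ := Prod.mk.inj h
    exact hc (le_antisymm hac hcb ▸ mem_interior_iff_mem_nhds.2 hU)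
  have hnhds := himage.isOpen_compl.mem_nhds hx
  rw [nhds_prod_eq, Filter.mem_prod_self_iff] at hnhds
  obtain ⟨N, hN, hsub⟩ := hnhds
  refine ⟨N, hN, fun a ha b hb c hc => interior_subset ?_⟩
  by_contra hcU
  exact hsub (Set.mk_mem_prod ha hb) ⟨((a, b), c), ⟨hcU, hc.1, hc.2⟩, rfl⟩


/-- For a compact topological lattice `L` (compact Hausdorff, with continuous binary
meet and join) and a point `x ∈ L`, the following are equivalent:
(i) every neighborhood `U` of `x` contains a neighborhood `V` of `x` which is a
sublattice of `L`;
(ii) every neighborhood `U` of `x` contains a neighborhood of `x` of the form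
`[y,z] = {w | y ≤ w ≤ z}` with `y ≤ z`. -/
theorem stmt9 {L : Type*} [TopologicalSpace L] [T2Space L] [CompactSpace L]
    [Lattice L] [TopologicalLattice L] (x : L) :
    (∀ U ∈ nhds x, ∃ V ∈ nhds x, V ⊆ U ∧
      ∀ a ∈ V, ∀ b ∈ V, a ⊓ b ∈ V ∧ a ⊔ b ∈ V) ↔
    (∀ U ∈ nhds x, ∃ y z : L, y ≤ z ∧ Set.Icc y z ⊆ U ∧ Set.Icc y z ∈ nhds x) := by
  have : OrderClosedTopology L := orderClosedTopology_of_continuousInf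
  constructor
  · intro h U hU
    obtain ⟨N, hN, hNU⟩ := exists_mem_nhds_forall_Icc_subset hU
    obtain ⟨C, hC, hCclosed, hCN⟩ := exists_mem_nhds_isClosed_subset hN
    obtain ⟨V, hV, hVC, hVlat⟩ := h C hC
    have hVN : closure V ⊆ N := (closure_minimal hVC hCclosed).trans hCN
    have hne : (closure V).Nonempty := ⟨x, subset_closure (mem_of_mem_nhds hV)⟩
    have hcompact : IsCompact (closure V) := isClosed_closure.isCompact
    obtain ⟨y, hy⟩ := hcompact.exists_isLeast_of_infClosed hne fun a ha b hb =>
      map_mem_closure₂ continuous_inf ha hb fun a ha b hb => (hVlat a ha b hb).1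
    obtain ⟨z, hz⟩ := hcompact.exists_isGreatest_of_supClosed hne fun a ha b hb =>
      map_mem_closure₂ continuous_sup ha hb fun a ha b hb => (hVlat a ha b hb).2
    exact ⟨y, z, hy.2 hz.1, hNU y (hVN hy.1) z (hVN hz.1), Filter.mem_of_superset hV
      fun w hw => ⟨hy.2 (subset_closure hw), hz.2 (subset_closure hw)⟩⟩
  · intro h U hU
    obtain ⟨y, z, -, hsub, hmem⟩ := h U hU
    exact ⟨Set.Icc y z, hmem, hsub, fun a ha b hb =>
      ⟨⟨le_inf ha.1 hb.1, inf_le_left.trans ha.2⟩,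
        ⟨ha.1.trans le_sup_left, sup_le ha.2 hb.2⟩⟩⟩
end

section
/- Let X be a finite set and cl a closure operator on X (an isotone, extensive, idempotent map from subsets of X to subsets of X), and let Δ(X,cl) = {f : X → [0,1] | for every t ∈ (0,1], the set f_t = {x ∈ X | f(x) ≥ t} is cl-closed}. Then Δ(X,cl) is a retract of [0,1]^X by a continuous order-preserving map: the map r : [0,1]^X → Δ(X,cl) defined by r(f)(x) = max{t ∈ [0,1] | x ∈ cl(f_t)} is well defined, continuous, order-preserving (for the pointwise orders), and restricts to the identity on Δ(X,cl). -/
open Classical in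
/-- The closure-operator retraction in max-min form: the maximum of `min_A f` over the sets `A`
whose closure contains `x`. -/
noncomputable def clRetraction {X : Type*} [Fintype X] (cl : Set X → Set X)
    (f : X → unitInterval) (x : X) : unitInterval :=
  (Finset.univ.filter fun A : Finset X => x ∈ cl (A : Set X)).sup fun A => A.inf f

lemma le_clRetraction_iff {X : Type*} [Fintype X] {cl : Set X → Set X}
    (hmono : Monotone cl) (hext : ∀ A : Set X, A ⊆ cl A)
    (f : X → unitInterval) (x : X) (t : unitInterval) :
    t ≤ clRetraction cl f x ↔ x ∈ cl {y : X | t ≤ f y} := by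
  classical
  constructor
  · intro h
    rcases eq_bot_or_bot_lt t with rfl | ht
    · exact hext _ (bot_le : ⊥ ≤ f x)
    · obtain ⟨A, hA, hle⟩ := (Finset.le_sup_iff ht).1 h
      exact hmono (fun y hy => Finset.le_inf_iff.1 hle y hy) (Finset.mem_filter.1 hA).2
  · intro h
    refine Finset.le_sup_of_le (b := Finset.univ.filter fun y => t ≤ f y) ?_ ?_
    · simpa using h
    · exact Finset.le_inf fun y hy => (Finset.mem_filter.1 hy).2

lemma continuous_clRetraction {X : Type*} [Fintype X] (cl : Set X → Set X) :
    Continuous (clRetraction cl) :=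
  continuous_pi fun _ => Continuous.finset_sup_apply fun _ _ =>
    Continuous.finset_inf_apply fun y _ => continuous_apply y

lemma monotone_clRetraction {X : Type*} [Fintype X] (cl : Set X → Set X) :
    Monotone (clRetraction cl) := fun _ _ h _ =>
  Finset.sup_mono_fun fun _ _ => Finset.inf_mono_fun fun y _ => h y

/-- Let `X` be a finite set and `cl` a closure operator on `X` (isotone, extensive,
idempotent).  Then the set `Δ(X,cl)` of functions `f : X → [0,1]` all of whose
superlevel sets `f_t` (`t ∈ (0,1]`) are `cl`-closed is a retract of `[0,1]^X` by a
continuous order-preserving map `r`, where `r f x = max {t | x ∈ cl (f_t)}`. -/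
theorem stmt11 {X : Type*} [Fintype X] (cl : Set X → Set X)
    (hmono : Monotone cl) (hext : ∀ A : Set X, A ⊆ cl A)
    (hidem : ∀ A : Set X, cl (cl A) = cl A) :
    ∃ r : (X → unitInterval) → (X → unitInterval),
      (∀ (f : X → unitInterval) (x : X),
        IsGreatest {t : unitInterval | x ∈ cl {y : X | t ≤ f y}} (r f x)) ∧
      (∀ f : X → unitInterval, ∀ t : unitInterval, 0 < t →
        cl {x : X | t ≤ r f x} = {x : X | t ≤ r f x}) ∧
      Continuous r ∧
      Monotone r ∧
      (∀ f : X → unitInterval,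
        (∀ t : unitInterval, 0 < t → cl {x : X | t ≤ f x} = {x : X | t ≤ f x}) →
        r f = f) := by
  have key := le_clRetraction_iff hmono hext
  refine ⟨clRetraction cl, fun f x => ⟨(key f x _).1 le_rfl, fun t ht => (key f x t).2 ht⟩,
    fun f t _ => ?_, continuous_clRetraction cl, monotone_clRetraction cl, fun f hf => ?_⟩
  · simp only [key, Set.ofPred_mem_eq, hidem]
  · funext x
    refine eq_of_forall_le_iff fun t => ?_
    rcases eq_bot_or_bot_lt t with rfl | ht
    · exact iff_of_true bot_le bot_le
    · rw [key, hf t ht, Set.mem_ofPred_eq]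
end

section
/- Let L be a finite lattice with more than one element, and let S ⊆ L × L be a set of pairs (x,y) each satisfying x < y and with y join-prime (meaning w ∨ z ≥ y implies w ≥ y or z ≥ y). Let Δ(L,S) = {f ∈ Δ(L) | for all (x,y) ∈ S, f(x) < 1 implies f(y) = 0}, topologized as a subspace of [0,1]^L. Then: (a) for every pair p < q in L with no element strictly between p and q, every convex combination (1−t)·(↓p) + t·(↓q), t ∈ [0,1], lies in Δ(L,S); (b) Δ(L,S) is pathwise connected; (c) Δ(L,S) is contractible. -/
open Set unitInterval

section DeltaLattice

variable {L : Type*} [Lattice L]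

open Classical in
/-- The function `(1 - t) · ↓p + t · ↓q` for `p ≤ q`. -/
noncomputable def principalSegment (p q : L) (t : I) : L → I :=
  fun x => if x ≤ p then 1 else if x ≤ q then t else 0

theorem principalSegment_mem_Delta {p q : L} (hpq : p ≤ q) (t : I) :
    principalSegment p q t ∈ Delta L := by
  intro s hs
  rcases le_or_gt s t with hst | hst
  · refine ⟨q, Set.ext fun y => ?_⟩
    by_cases hp : y ≤ p
    · simp [principalSegment, hp, hp.trans hpq, le_one']
    · by_cases hq : y ≤ q <;> simp [principalSegment, hp, hq, hst, hs.ne']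
  · refine ⟨p, Set.ext fun y => ?_⟩
    by_cases hp : y ≤ p
    · simp [principalSegment, hp, le_one']
    · by_cases hq : y ≤ q <;> simp [principalSegment, hp, hq, hst, hs.ne']

theorem principalSegment_mem_DeltaS {S : Set (L × L)} (hS : ∀ p ∈ S, p.1 < p.2)
    (hprime : ∀ p ∈ S, ∀ w z : L, p.2 ≤ w ⊔ z → p.2 ≤ w ∨ p.2 ≤ z)
    {p q : L} (hpq : p ⩿ q) (t : I) : principalSegment p q t ∈ DeltaS L S := by
  refine ⟨principalSegment_mem_Delta hpq.le t, fun r hr hlt => ?_⟩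
  have hxp : ¬ r.1 ≤ p := fun h => by simp [principalSegment, h] at hlt
  have hyp : ¬ r.2 ≤ p := fun h => hxp ((hS r hr).le.trans h)
  have hyq : ¬ r.2 ≤ q := fun h => by
    have hxq : r.1 ≤ q := (hS r hr).le.trans h
    have hjoin : p ⊔ r.1 = q := (hpq.eq_or_eq le_sup_left (sup_le hpq.le hxq)).resolve_left
      fun h => hxp (le_sup_right.trans h.le)
    rcases hprime r hr p r.1 (hjoin ▸ h) with h | h
    · exact hyp h
    · exact (hS r hr).not_ge h
  simp [principalSegment, hyp, hyq]

/-- The join of two functions, which on superlevel sets is the join of principal ideals. -/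
noncomputable def idealJoin [Fintype L] (f g : L → I) : L → I :=
  open Classical in fun y =>
    (Finset.univ.filter fun p : L × L => y ≤ p.1 ⊔ p.2).sup fun p => f p.1 ⊓ g p.2

theorem le_idealJoin_iff [Fintype L] {f g : L → I} {t : I} (ht : 0 < t) {y : L} :
    t ≤ idealJoin f g y ↔ ∃ a b, y ≤ a ⊔ b ∧ t ≤ f a ∧ t ≤ g b := by
  classical
  rw [idealJoin, Finset.le_sup_iff (show ⊥ < t from ht)]
  simp

theorem continuous_idealJoin [Fintype L] :
    Continuous fun p : (L → I) × (L → I) => idealJoin p.1 p.2 := by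
  refine continuous_pi fun y => ?_
  unfold idealJoin
  exact Continuous.finset_sup_apply fun q _ => by fun_prop

theorem idealJoin_mem_Delta [Fintype L] {f g : L → I} (hf : f ∈ Delta L) (hg : g ∈ Delta L) :
    idealJoin f g ∈ Delta L := by
  intro t ht
  obtain ⟨a, ha⟩ := hf t ht
  obtain ⟨b, hb⟩ := hg t ht
  refine ⟨a ⊔ b, Set.ext fun y => ?_⟩
  simp only [Set.ext_iff, mem_ofPred_eq, mem_Iic] at ha hb ⊢
  simp only [le_idealJoin_iff ht, ha, hb]
  exact ⟨fun ⟨_, _, h, h₁, h₂⟩ => h.trans (sup_le_sup h₁ h₂), fun h => ⟨a, b, h, le_rfl, le_rfl⟩⟩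

theorem antitone_of_mem_Delta {f : L → I} (hf : f ∈ Delta L) : Antitone f := by
  intro a b hab
  rcases eq_or_lt_of_le (nonneg' : 0 ≤ f b) with h | h
  · rw [← h]; exact nonneg'
  obtain ⟨x, hx⟩ := hf (f b) h
  simp only [Set.ext_iff, mem_ofPred_eq, mem_Iic] at hx
  exact (hx a).2 (hab.trans ((hx b).1 le_rfl))

theorem apply_bot_of_mem_Delta [OrderBot L] {f : L → I} (hf : f ∈ Delta L) : f ⊥ = 1 := by
  obtain ⟨x, hx⟩ := hf 1 zero_lt_one
  simp only [Set.ext_iff, mem_ofPred_eq, mem_Iic] at hx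
  exact le_antisymm le_one' ((hx ⊥).2 bot_le)

theorem idealJoin_mem_DeltaS [Fintype L] [OrderBot L] {S : Set (L × L)}
    (hprime : ∀ p ∈ S, ∀ w z : L, p.2 ≤ w ⊔ z → p.2 ≤ w ∨ p.2 ≤ z)
    {f g : L → I} (hf : f ∈ DeltaS L S) (hg : g ∈ DeltaS L S) :
    idealJoin f g ∈ DeltaS L S := by
  refine ⟨idealJoin_mem_Delta hf.1 hg.1, fun p hp hlt => ?_⟩
  by_contra hne
  have hpos : 0 < idealJoin f g p.2 := pos_iff_ne_zero.2 hne
  obtain ⟨a, b, hab, ha, hb⟩ := (le_idealJoin_iff hpos).1 le_rfl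
  refine hlt.not_ge ((le_idealJoin_iff zero_lt_one).2 ?_)
  rcases hprime p hp a b hab with h | h
  · refine ⟨p.1, ⊥, le_sup_left, ?_, (apply_bot_of_mem_Delta hg.1).ge⟩
    by_contra! hx
    exact ((hpos.trans_le ha).trans_le (antitone_of_mem_Delta hf.1 h)).ne' (hf.2 p hp hx)
  · refine ⟨⊥, p.1, le_sup_right, (apply_bot_of_mem_Delta hf.1).ge, ?_⟩
    by_contra! hx
    exact ((hpos.trans_le hb).trans_le (antitone_of_mem_Delta hg.1 h)).ne' (hg.2 p hp hx)

theorem idealJoin_bot [Fintype L] [OrderBot L] {f : L → I} (hf : f ∈ Delta L) :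
    idealJoin (principalSegment ⊥ ⊥ 0) f = f := by
  funext y
  refine eq_of_forall_le_iff fun t => ?_
  rcases eq_or_lt_of_le (nonneg' : 0 ≤ t) with rfl | ht
  · simp
  rw [le_idealJoin_iff ht]
  constructor
  · rintro ⟨a, b, h, ha, hb⟩
    have : a = ⊥ := by
      by_contra hne
      simp [principalSegment, hne, ht.not_ge] at ha
    subst this
    exact hb.trans (antitone_of_mem_Delta hf (by simpa using h))
  · exact fun h => ⟨⊥, y, le_sup_right, by simp [principalSegment, le_one'], h⟩

theorem idealJoin_top [Fintype L] [BoundedOrder L] {f : L → I} (hf : f ∈ Delta L) :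
    idealJoin (principalSegment ⊤ ⊤ 0) f = principalSegment ⊤ ⊤ 0 := by
  funext y
  have : (principalSegment ⊤ ⊤ 0 : L → I) y = 1 := by simp [principalSegment]
  rw [this]
  refine le_antisymm le_one' ((le_idealJoin_iff zero_lt_one).2 ⟨⊤, ⊥, by simp, ?_, ?_⟩)
  · simp [principalSegment]
  · exact (apply_bot_of_mem_Delta hf).ge

theorem continuous_principalSegment (p q : L) : Continuous (principalSegment p q) := by
  refine continuous_pi fun x => ?_
  unfold principalSegment
  split_ifs <;> fun_prop

/-- The characteristic function of `↓q`, as a point of `Δ(L,S)`. -/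
noncomputable def principalPoint {S : Set (L × L)} (hS : ∀ p ∈ S, p.1 < p.2)
    (hprime : ∀ p ∈ S, ∀ w z : L, p.2 ≤ w ⊔ z → p.2 ≤ w ∨ p.2 ≤ z) (q : L) : DeltaS L S :=
  ⟨principalSegment q q 0, principalSegment_mem_DeltaS hS hprime WCovBy.rfl 0⟩

theorem joined_principalPoint_of_covBy {S : Set (L × L)} (hS : ∀ p ∈ S, p.1 < p.2)
    (hprime : ∀ p ∈ S, ∀ w z : L, p.2 ≤ w ⊔ z → p.2 ≤ w ∨ p.2 ≤ z) {p q : L} (hpq : p ⋖ q) :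
    Joined (principalPoint hS hprime p) (principalPoint hS hprime q) := by
  refine ⟨⟨⟨fun t => ⟨principalSegment p q t,
    principalSegment_mem_DeltaS hS hprime hpq.wcovBy t⟩,
    (continuous_principalSegment p q).subtype_mk _⟩, ?_, ?_⟩⟩
  · refine Subtype.ext (funext fun x => ?_)
    simp [principalPoint, principalSegment]
  · refine Subtype.ext (funext fun x => ?_)
    by_cases hp : x ≤ p
    · simp [principalPoint, principalSegment, hp, hp.trans hpq.le]
    · simp [principalPoint, principalSegment, hp]

theorem joined_principalPoint_bot [Fintype L] [OrderBot L] {S : Set (L × L)} (hS : ∀ p ∈ S, p.1 < p.2)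
    (hprime : ∀ p ∈ S, ∀ w z : L, p.2 ≤ w ⊔ z → p.2 ≤ w ∨ p.2 ≤ z) (q : L) :
    Joined (principalPoint hS hprime ⊥) (principalPoint hS hprime q) := by
  induction q using WellFoundedLT.induction with
  | ind q ih =>
    rcases eq_or_ne q ⊥ with rfl | hq
    · exact Joined.refl _
    · obtain ⟨p, -, hp⟩ := exists_le_covBy_of_lt (bot_lt_iff_ne_bot.2 hq)
      exact (ih p hp.lt).trans (joined_principalPoint_of_covBy hS hprime hp)

theorem contractibleSpace_DeltaS [Fintype L] [BoundedOrder L] {S : Set (L × L)} (hS : ∀ p ∈ S, p.1 < p.2)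
    (hprime : ∀ p ∈ S, ∀ w z : L, p.2 ≤ w ⊔ z → p.2 ≤ w ∨ p.2 ≤ z) :
    ContractibleSpace (DeltaS L S) := by
  obtain ⟨γ⟩ := joined_principalPoint_bot hS hprime (⊤ : L)
  rw [contractible_iff_id_nullhomotopic]
  refine ⟨principalPoint hS hprime ⊤, ⟨⟨⟨fun x => ⟨idealJoin (γ x.1).1 x.2.1,
    idealJoin_mem_DeltaS hprime (γ x.1).2 x.2.2⟩, ?_⟩, fun f => ?_, fun f => ?_⟩⟩⟩
  · exact (continuous_idealJoin.comp
      (f := fun x : I × DeltaS L S => ((γ x.1).1, x.2.1)) (by fun_prop)).subtype_mk _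
  · refine Subtype.ext ?_
    change idealJoin (γ 0).1 f.1 = _
    rw [γ.source]
    exact idealJoin_bot f.2.1
  · refine Subtype.ext ?_
    change idealJoin (γ 1).1 f.1 = _
    rw [γ.target]
    exact idealJoin_top f.2.1

end DeltaLattice

/-- Let `L` be a finite lattice with more than one element and `S ⊆ L × L` a set of
pairs `(x,y)` with `x < y` and `y` join-prime.  Then (a) for every covering pair
`p < q` in `L` (no element strictly between), every convex combination
`(1-t)·(↓p) + t·(↓q)` lies in `Δ(L,S)`; (b) `Δ(L,S)` is pathwise connected;
(c) `Δ(L,S)` is contractible. -/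
theorem stmt12 {L : Type*} [Fintype L] [Lattice L] [Nontrivial L]
    (S : Set (L × L)) (hS : ∀ p ∈ S, p.1 < p.2)
    (hprime : ∀ p ∈ S, ∀ w z : L, p.2 ≤ w ⊔ z → p.2 ≤ w ∨ p.2 ≤ z) :
    (∀ p q : L, p < q → (∀ r : L, ¬ (p < r ∧ r < q)) →
      ∀ t : unitInterval, ∃ g ∈ DeltaS L S, ∀ x : L,
        (g x : ℝ) =
          (1 - (t : ℝ)) * Set.indicator (Set.Iic p) (fun _ => (1 : ℝ)) x +
            (t : ℝ) * Set.indicator (Set.Iic q) (fun _ => (1 : ℝ)) x) ∧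
    PathConnectedSpace ↥(DeltaS L S) ∧
    ContractibleSpace ↥(DeltaS L S) := by
  let _ : BoundedOrder L := Fintype.toBoundedOrder L
  have hc := contractibleSpace_DeltaS hS hprime
  refine ⟨fun p q hpq hcov t => ⟨principalSegment p q t,
    principalSegment_mem_DeltaS hS hprime ⟨hpq.le, fun r h₁ h₂ => hcov r ⟨h₁, h₂⟩⟩ t,
    fun x => ?_⟩, inferInstance, hc⟩
  by_cases hp : x ≤ p
  · simp [principalSegment, hp, hp.trans hpq.le]
  · by_cases hq : x ≤ q <;> simp [principalSegment, hp, hq]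
end

section
/- Let h : P → Q be an isotone map of finite partially ordered sets, and define Δ(h) : Δ(P) → Δ(Q) by (Δ(h)(f))(y) = max({f(x) | x ∈ P, h(x) ≥ y} ∪ {0}) for y ∈ Q. Then: (a) Δ(h)(f) ∈ Δ(Q) for every f ∈ Δ(P), and Δ(h) is isotone for the pointwise orders; (b) the assignment is functorial: Δ(id_P) = id_{Δ(P)} and Δ(h' ∘ h) = Δ(h') ∘ Δ(h) for composable isotone maps; (c) if P and Q have least upper bounds (respectively greatest lower bounds) of pairs and h preserves them, then Δ(h)(f ∨ g) = Δ(h)(f) ∨ Δ(h)(g) (respectively Δ(h)(f ∧ g) = Δ(h)(f) ∧ Δ(h)(g)) for all f, g ∈ Δ(P). -/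
/-- `IsDeltaMap h D` says that `D` is the map induced by `h` on the simplicial
complexes: `(D f) y = max ({f x | h x ≥ y} ∪ {0})`. -/
def IsDeltaMap {P Q : Type*} [PartialOrder P] [PartialOrder Q] (h : P → Q)
    (D : (P → unitInterval) → (Q → unitInterval)) : Prop :=
  ∀ (f : P → unitInterval) (y : Q),
    IsGreatest ({t : unitInterval | ∃ x : P, y ≤ h x ∧ f x = t} ∪ {0}) (D f y)

theorem unitInterval.le_of_forall_pos_le {a b : unitInterval}
    (hab : ∀ t, 0 < t → t ≤ a → t ≤ b) : a ≤ b := by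
  rcases eq_or_ne a 0 with rfl | ha
  · exact unitInterval.nonneg'
  · exact hab a (unitInterval.pos_iff_ne_zero.2 ha) le_rfl

theorem isLUB_pair_le_iff {P : Type*} [PartialOrder P] {a b s x : P} (hs : IsLUB {a, b} s) :
    s ≤ x ↔ a ≤ x ∧ b ≤ x := by
  rw [isLUB_le_iff hs]
  simp [upperBounds]

theorem le_isGLB_pair_iff {P : Type*} [PartialOrder P] {a b m x : P} (hm : IsGLB {a, b} m) :
    x ≤ m ↔ x ≤ a ∧ x ≤ b := by
  rw [le_isGLB_iff hm]
  simp [lowerBounds]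

namespace Delta

variable {P : Type*} [PartialOrder P]

theorem exists_le_iff {f : P → unitInterval} (hf : f ∈ Delta P) {t : unitInterval} (ht : 0 < t) :
    ∃ x, ∀ y, t ≤ f y ↔ y ≤ x := by
  obtain ⟨x, hx⟩ := hf t ht
  exact ⟨x, fun y => Set.ext_iff.1 hx y⟩

theorem mem_of_exists_le_iff {f : P → unitInterval}
    (hf : ∀ t, 0 < t → ∃ x, ∀ y, t ≤ f y ↔ y ≤ x) : f ∈ Delta P := by
  intro t ht
  obtain ⟨x, hx⟩ := hf t ht
  exact ⟨x, Set.ext hx⟩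

theorem antitone_s13 {f : P → unitInterval} (hf : f ∈ Delta P) : Antitone f := by
  intro x y hxy
  refine unitInterval.le_of_forall_pos_le fun t ht hty => ?_
  obtain ⟨z, hz⟩ := exists_le_iff hf ht
  exact (hz x).2 (hxy.trans ((hz y).1 hty))

/-- When pairwise meets exist, `Δ(P)` is closed under pointwise minima. -/
theorem inf_mem_s13 (hP : ∀ a b : P, ∃ m, IsGLB {a, b} m) {f g : P → unitInterval}
    (hf : f ∈ Delta P) (hg : g ∈ Delta P) : f ⊓ g ∈ Delta P := by
  refine mem_of_exists_le_iff fun t ht => ?_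
  obtain ⟨a, ha⟩ := exists_le_iff hf ht
  obtain ⟨b, hb⟩ := exists_le_iff hg ht
  obtain ⟨m, hm⟩ := hP a b
  refine ⟨m, fun y => ?_⟩
  rw [Pi.inf_apply, le_inf_iff, ha, hb, le_isGLB_pair_iff hm]

/-- When pairwise joins exist, `f` and `g` have an upper bound in `Δ(P)` whose level sets are
generated by joins of elements of the level sets of `f` and `g`. -/
theorem exists_join [Fintype P] (hP : ∀ a b : P, ∃ s, IsLUB {a, b} s) {f g : P → unitInterval}
    (hf : f ∈ Delta P) (hg : g ∈ Delta P) :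
    ∃ k ∈ Delta P, f ≤ k ∧ g ≤ k ∧ ∀ t, 0 < t → ∀ x, t ≤ k x →
      ∃ a b s, IsLUB {a, b} s ∧ x ≤ s ∧ t ≤ f a ∧ t ≤ g b := by
  classical
  choose j hj using hP
  let k : P → unitInterval := fun x =>
    (Finset.univ.filter fun p : P × P => x ≤ j p.1 p.2).sup fun p => f p.1 ⊓ g p.2
  have hk (t : unitInterval) (ht : 0 < t) (x : P) :
      t ≤ k x ↔ ∃ a b, x ≤ j a b ∧ t ≤ f a ∧ t ≤ g b := by
    simp only [k]
    rw [Finset.le_sup_iff (show ⊥ < t from ht)]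
    simp
  refine ⟨k, mem_of_exists_le_iff fun t ht => ?_, fun x => ?_, fun x => ?_, fun t ht x hx => ?_⟩
  · obtain ⟨a, ha⟩ := exists_le_iff hf ht
    obtain ⟨b, hb⟩ := exists_le_iff hg ht
    refine ⟨j a b, fun y => ?_⟩
    rw [hk t ht]
    constructor
    · rintro ⟨c, d, hy, hc, hd⟩
      have hab := (isLUB_pair_le_iff (hj a b)).1 le_rfl
      exact hy.trans ((isLUB_pair_le_iff (hj c d)).2
        ⟨((ha c).1 hc).trans hab.1, ((hb d).1 hd).trans hab.2⟩)
    · exact fun hy => ⟨a, b, hy, (ha a).2 le_rfl, (hb b).2 le_rfl⟩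
  · refine unitInterval.le_of_forall_pos_le fun t ht htx => (hk t ht x).2 ?_
    obtain ⟨b, hb⟩ := exists_le_iff hg ht
    exact ⟨x, b, ((isLUB_pair_le_iff (hj x b)).1 le_rfl).1, htx, (hb b).2 le_rfl⟩
  · refine unitInterval.le_of_forall_pos_le fun t ht htx => (hk t ht x).2 ?_
    obtain ⟨a, ha⟩ := exists_le_iff hf ht
    exact ⟨a, x, ((isLUB_pair_le_iff (hj a x)).1 le_rfl).2, (ha a).2 le_rfl, htx⟩
  · obtain ⟨a, b, hxs, hta, htb⟩ := (hk t ht x).1 hx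
    exact ⟨a, b, j a b, hj a b, hxs, hta, htb⟩

end Delta

theorem exists_isDeltaMap {P Q : Type*} [Finite P] [PartialOrder P] [PartialOrder Q] (h : P → Q) :
    ∃ D, IsDeltaMap h D := by
  have key (f : P → unitInterval) (y : Q) :
      ∃ t, IsGreatest ({t : unitInterval | ∃ x : P, y ≤ h x ∧ f x = t} ∪ {0}) t := by
    have hfin : ({t : unitInterval | ∃ x : P, y ≤ h x ∧ f x = t} ∪ {0}).Finite :=
      ((Set.toFinite {x | y ≤ h x}).image f).union (Set.finite_singleton 0)
    exact hfin.exists_maximal ⟨0, Or.inr rfl⟩ |>.imp fun t ht =>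
      ⟨ht.prop, fun u hu => (le_total u t).elim id fun htu => ht.le_of_ge hu htu⟩
  choose D hD using key
  exact ⟨D, hD⟩

namespace IsDeltaMap

variable {P Q R : Type*} [PartialOrder P] [PartialOrder Q] [PartialOrder R]
  {h : P → Q} {D : (P → unitInterval) → (Q → unitInterval)}

theorem le_apply_iff (hD : IsDeltaMap h D) (f : P → unitInterval) (y : Q) {t : unitInterval}
    (ht : 0 < t) : t ≤ D f y ↔ ∃ x, y ≤ h x ∧ t ≤ f x := by
  constructor
  · intro hty
    rcases (hD f y).1 with ⟨x, hx, hfx⟩ | h0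
    · exact ⟨x, hx, hfx ▸ hty⟩
    · exact absurd (ht.trans_le hty) (by rw [Set.mem_singleton_iff.1 h0]; exact lt_irrefl 0)
  · rintro ⟨x, hx, htx⟩
    exact htx.trans ((hD f y).2 (Or.inl ⟨x, hx, rfl⟩))

theorem mono (hD : IsDeltaMap h D) : Monotone D := by
  intro f g hfg y
  refine unitInterval.le_of_forall_pos_le fun t ht hty => ?_
  obtain ⟨x, hx, htx⟩ := (hD.le_apply_iff f y ht).1 hty
  exact (hD.le_apply_iff g y ht).2 ⟨x, hx, htx.trans (hfg x)⟩

theorem mem_delta (hD : IsDeltaMap h D) (hmono : Monotone h) {f : P → unitInterval}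
    (hf : f ∈ Delta P) : D f ∈ Delta Q := by
  refine Delta.mem_of_exists_le_iff fun t ht => ?_
  obtain ⟨x, hx⟩ := Delta.exists_le_iff hf ht
  refine ⟨h x, fun y => (hD.le_apply_iff f y ht).trans ⟨?_, fun hy => ⟨x, hy, (hx x).2 le_rfl⟩⟩⟩
  rintro ⟨z, hz, htz⟩
  exact hz.trans (hmono ((hx z).1 htz))

theorem id_apply {D : (P → unitInterval) → (P → unitInterval)} (hD : IsDeltaMap (id : P → P) D)
    {f : P → unitInterval} (hf : f ∈ Delta P) : D f = f := by
  funext y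
  apply le_antisymm <;> refine unitInterval.le_of_forall_pos_le fun t ht hty => ?_
  · obtain ⟨x, hx, htx⟩ := (hD.le_apply_iff f y ht).1 hty
    exact htx.trans (Delta.antitone_s13 hf hx)
  · exact (hD.le_apply_iff f y ht).2 ⟨y, le_rfl, hty⟩

theorem comp_apply {h' : Q → R} {D' : (Q → unitInterval) → (R → unitInterval)}
    {Dc : (P → unitInterval) → (R → unitInterval)} (hD : IsDeltaMap h D)
    (hD' : IsDeltaMap h' D') (hDc : IsDeltaMap (h' ∘ h) Dc) (hmono' : Monotone h')
    (f : P → unitInterval) : Dc f = D' (D f) := by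
  funext y
  apply le_antisymm <;> refine unitInterval.le_of_forall_pos_le fun t ht hty => ?_
  · obtain ⟨x, hx, htx⟩ := (hDc.le_apply_iff f y ht).1 hty
    exact (hD'.le_apply_iff _ y ht).2
      ⟨h x, hx, (hD.le_apply_iff f _ ht).2 ⟨x, le_rfl, htx⟩⟩
  · obtain ⟨z, hz, htz⟩ := (hD'.le_apply_iff _ y ht).1 hty
    obtain ⟨x, hx, htx⟩ := (hD.le_apply_iff f z ht).1 htz
    exact (hDc.le_apply_iff f y ht).2 ⟨x, hz.trans (hmono' hx), htx⟩

theorem join_le [Fintype P] (hD : IsDeltaMap h D) (hmono : Monotone h)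
    (hP : ∀ a b : P, ∃ s, IsLUB {a, b} s)
    (hh : ∀ a b s : P, IsLUB {a, b} s → IsLUB {h a, h b} (h s))
    {f g j : P → unitInterval} (hf : f ∈ Delta P) (hg : g ∈ Delta P)
    (hj : ∀ k ∈ Delta P, f ≤ k → g ≤ k → j ≤ k)
    {k : Q → unitInterval} (hk : k ∈ Delta Q) (hfk : D f ≤ k) (hgk : D g ≤ k) : D j ≤ k := by
  obtain ⟨u, hu, hfu, hgu, hlevel⟩ := Delta.exists_join hP hf hg
  intro y
  refine unitInterval.le_of_forall_pos_le fun t ht hty => ?_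
  obtain ⟨x, hx, htx⟩ := (hD.le_apply_iff j y ht).1 hty
  obtain ⟨a, b, s, hs, hxs, hta, htb⟩ := hlevel t ht x (htx.trans (hj u hu hfu hgu x))
  obtain ⟨z, hz⟩ := Delta.exists_le_iff hk ht
  have haz := (hz _).1 (((hD.le_apply_iff f (h a) ht).2 ⟨a, le_rfl, hta⟩).trans (hfk _))
  have hbz := (hz _).1 (((hD.le_apply_iff g (h b) ht).2 ⟨b, le_rfl, htb⟩).trans (hgk _))
  exact (hz y).2 ((hx.trans (hmono hxs)).trans ((isLUB_pair_le_iff (hh a b s hs)).2 ⟨haz, hbz⟩))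

theorem le_meet (hD : IsDeltaMap h D) (hP : ∀ a b : P, ∃ m, IsGLB {a, b} m)
    (hh : ∀ a b m : P, IsGLB {a, b} m → IsGLB {h a, h b} (h m))
    {f g m : P → unitInterval} (hf : f ∈ Delta P) (hg : g ∈ Delta P)
    (hm : ∀ k ∈ Delta P, k ≤ f → k ≤ g → k ≤ m)
    {k : Q → unitInterval} (hkf : k ≤ D f) (hkg : k ≤ D g) : k ≤ D m := by
  intro y
  refine unitInterval.le_of_forall_pos_le fun t ht hty => ?_
  obtain ⟨a, hya, hta⟩ := (hD.le_apply_iff f y ht).1 (hty.trans (hkf y))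
  obtain ⟨b, hyb, htb⟩ := (hD.le_apply_iff g y ht).1 (hty.trans (hkg y))
  obtain ⟨c, hc⟩ := hP a b
  obtain ⟨hca, hcb⟩ := (le_isGLB_pair_iff hc).1 le_rfl
  refine (hD.le_apply_iff m y ht).2 ⟨c, (le_isGLB_pair_iff (hh a b c hc)).2 ⟨hya, hyb⟩, ?_⟩
  exact (le_inf (hta.trans (Delta.antitone_s13 hf hca)) (htb.trans (Delta.antitone_s13 hg hcb))).trans
    (hm (f ⊓ g) (Delta.inf_mem_s13 hP hf hg) inf_le_left inf_le_right c)

end IsDeltaMap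

/-- For an isotone map `h : P → Q` of finite posets, the induced map
`Δ(h) : Δ(P) → Δ(Q)`, `(Δ(h) f) y = max ({f x | h x ≥ y} ∪ {0})`, exists; it
(a) carries `Δ(P)` into `Δ(Q)` and is isotone; (b) is functorial (`Δ(id) = id` and
`Δ(h' ∘ h) = Δ(h') ∘ Δ(h)` on `Δ(P)`); and (c) if `P` and `Q` have pairwise joins
(resp. meets) and `h` preserves them, then `Δ(h)` preserves least upper bounds
(resp. greatest lower bounds) of pairs in `Δ(P)`. -/
theorem stmt13 {P Q R : Type*} [Fintype P] [Fintype Q] [Fintype R]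
    [PartialOrder P] [PartialOrder Q] [PartialOrder R]
    (h : P → Q) (h' : Q → R) (hmono : Monotone h) (hmono' : Monotone h') :
    (∃ D, IsDeltaMap h D) ∧
    (∀ D, IsDeltaMap h D →
      ((∀ f ∈ Delta P, D f ∈ Delta Q) ∧
       (∀ f g : P → unitInterval, f ∈ Delta P → g ∈ Delta P → f ≤ g → D f ≤ D g) ∧
       (∀ Did, IsDeltaMap (id : P → P) Did → ∀ f ∈ Delta P, Did f = f) ∧
       (∀ D' Dc, IsDeltaMap h' D' → IsDeltaMap (h' ∘ h) Dc →
         ∀ f ∈ Delta P, Dc f = D' (D f)) ∧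
       ((∀ a b : P, ∃ s, IsLUB {a, b} s) → (∀ a b : Q, ∃ s, IsLUB {a, b} s) →
         (∀ a b s : P, IsLUB {a, b} s → IsLUB {h a, h b} (h s)) →
         ∀ f g j : P → unitInterval, f ∈ Delta P → g ∈ Delta P → j ∈ Delta P →
           (f ≤ j ∧ g ≤ j ∧ ∀ k ∈ Delta P, f ≤ k → g ≤ k → j ≤ k) →
           (D f ≤ D j ∧ D g ≤ D j ∧
             ∀ k ∈ Delta Q, D f ≤ k → D g ≤ k → D j ≤ k)) ∧
       ((∀ a b : P, ∃ m, IsGLB {a, b} m) → (∀ a b : Q, ∃ m, IsGLB {a, b} m) →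
         (∀ a b m : P, IsGLB {a, b} m → IsGLB {h a, h b} (h m)) →
         ∀ f g m : P → unitInterval, f ∈ Delta P → g ∈ Delta P → m ∈ Delta P →
           (m ≤ f ∧ m ≤ g ∧ ∀ k ∈ Delta P, k ≤ f → k ≤ g → k ≤ m) →
           (D m ≤ D f ∧ D m ≤ D g ∧
             ∀ k ∈ Delta Q, k ≤ D f → k ≤ D g → k ≤ D m)))) := by
  refine ⟨exists_isDeltaMap h, fun D hD => ⟨fun f hf => hD.mem_delta hmono hf,
    fun f g _ _ hfg => hD.mono hfg, fun Did hDid f hf => hDid.id_apply hf,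
    fun D' Dc hD' hDc f _ => hD.comp_apply hD' hDc hmono' f, ?_, ?_⟩⟩
  · rintro hP - hh f g j hf hg - ⟨hfj, hgj, hj⟩
    exact ⟨hD.mono hfj, hD.mono hgj, fun k hk => hD.join_le hmono hP hh hf hg hj hk⟩
  · rintro hP - hh f g m hf hg - ⟨hmf, hmg, hm⟩
    exact ⟨hD.mono hmf, hD.mono hmg, fun k _ => hD.le_meet hP hh hf hg hm⟩
end

section
/- Let P and Q be finite partially ordered sets and h : P → Q a map such that the inverse image under h of every principal ideal of Q is a principal ideal of P. Then: (a) h is isotone; (b) for every f ∈ Δ(Q), the composite f ∘ h belongs to Δ(P); (c) the map Δ'(h) : Δ(Q) → Δ(P), f ↦ f ∘ h, preserves pointwise infima, i.e. Δ'(h)(f ∧ g) = Δ'(h)(f) ∧ Δ'(h)(g) when Q and P have pairwise meets, and carries the greatest element of Δ(Q) (the constant function 1) to the greatest element of Δ(P). Moreover, if P and Q are finite join-semilattices with least elements and h preserves binary joins and least elements, then h satisfies the hypothesis that inverse images of principal ideals are principal ideals. -/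
theorem inf_mem_Delta_s14 {P : Type*} [PartialOrder P] (hP : ∀ a b : P, ∃ m, IsGLB {a, b} m)
    {f g : P → unitInterval} (hf : f ∈ Delta P) (hg : g ∈ Delta P) : f ⊓ g ∈ Delta P := by
  intro t ht
  obtain ⟨a, ha⟩ := hf t ht
  obtain ⟨b, hb⟩ := hg t ht
  obtain ⟨m, hm⟩ := hP a b
  refine ⟨m, Set.ext fun y => ?_⟩
  have hfy : t ≤ f y ↔ y ≤ a := Set.ext_iff.mp ha y
  have hgy : t ≤ g y ↔ y ≤ b := Set.ext_iff.mp hb y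
  simp [le_inf_iff, hfy, hgy, le_isGLB_iff hm]

theorem comp_mem_Delta {P Q : Type*} [PartialOrder P] [PartialOrder Q] {h : P → Q}
    (hh : ∀ q : Q, ∃ p : P, h ⁻¹' Set.Iic q = Set.Iic p) {f : Q → unitInterval}
    (hf : f ∈ Delta Q) : f ∘ h ∈ Delta P := by
  intro t ht
  obtain ⟨q, hq⟩ := hf t ht
  obtain ⟨p, hp⟩ := hh q
  exact ⟨p, by rw [← hp, ← hq]; rfl⟩

theorem monotone_of_preimage_Iic {P Q : Type*} [Preorder P] [Preorder Q] {h : P → Q}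
    (hh : ∀ q : Q, ∃ p : P, h ⁻¹' Set.Iic q = Set.Iic p) : Monotone h := by
  intro a b hab
  obtain ⟨p, hp⟩ := hh (h b)
  have hb : b ∈ Set.Iic p := hp ▸ (le_refl (h b) : b ∈ h ⁻¹' Set.Iic (h b))
  have ha : a ∈ h ⁻¹' Set.Iic (h b) := hp ▸ (hab.trans hb : a ∈ Set.Iic p)
  exact ha

theorem monotone_of_map_isLUB_pair {P Q : Type*} [Preorder P] [Preorder Q] {h : P → Q}
    (hh : ∀ a b s : P, IsLUB {a, b} s → IsLUB {h a, h b} (h s)) : Monotone h := by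
  intro a b hab
  have hb : IsLUB {a, b} b :=
    IsGreatest.isLUB ⟨by simp, by simp [hab]⟩
  exact (hh a b b hb).1 (by simp)

theorem exists_preimage_Iic_eq_Iic {P Q : Type*} [Finite P] [PartialOrder P] [Preorder Q]
    {h : P → Q} (hP : ∀ a b : P, ∃ s, IsLUB {a, b} s)
    (hh : ∀ a b s : P, IsLUB {a, b} s → IsLUB {h a, h b} (h s))
    {q : Q} (hq : (h ⁻¹' Set.Iic q).Nonempty) : ∃ p : P, h ⁻¹' Set.Iic q = Set.Iic p := by
  obtain ⟨m, hm⟩ := (Set.toFinite (h ⁻¹' Set.Iic q)).exists_maximal hq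
  have hmq : h m ≤ q := hm.1
  refine ⟨m, Set.Subset.antisymm (fun y hy => ?_) fun y hy =>
    (monotone_of_map_isLUB_pair hh hy).trans hmq⟩
  have hyq : h y ≤ q := hy
  obtain ⟨s, hs⟩ := hP y m
  have hsq : h s ≤ q := (hh y m s hs).2 (by simp [hyq, hmq])
  have hys : y ≤ s := hs.1 (by simp)
  have hms : m ≤ s := hs.1 (by simp)
  exact hys.trans (hm.2 hsq hms)

/-- Let `h : P → Q` be a map of finite posets such that the inverse image of every
principal ideal of `Q` is a principal ideal of `P`.  Then (a) `h` is isotone;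
(b) `f ∘ h ∈ Δ(P)` for every `f ∈ Δ(Q)`; (c) `Δ'(h) : f ↦ f ∘ h` carries greatest
lower bounds of pairs in `Δ(Q)` to greatest lower bounds of pairs in `Δ(P)` (when `P`
and `Q` have pairwise meets) and carries the greatest element of `Δ(Q)` (the constant
function `1`) to the greatest element of `Δ(P)`.  Moreover, if `P` and `Q` have
pairwise joins and least elements and `h` preserves them, then `h` satisfies the
principal-ideal hypothesis. -/
theorem stmt14 {P Q : Type*} [Fintype P] [Fintype Q] [PartialOrder P] [PartialOrder Q]
    (h : P → Q) :
    ((∀ q : Q, ∃ p : P, h ⁻¹' Set.Iic q = Set.Iic p) →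
      (Monotone h ∧
       (∀ f ∈ Delta Q, f ∘ h ∈ Delta P) ∧
       ((∀ a b : P, ∃ m, IsGLB {a, b} m) → (∀ a b : Q, ∃ m, IsGLB {a, b} m) →
         ∀ f g m : Q → unitInterval, f ∈ Delta Q → g ∈ Delta Q → m ∈ Delta Q →
           (m ≤ f ∧ m ≤ g ∧ ∀ k ∈ Delta Q, k ≤ f → k ≤ g → k ≤ m) →
           (m ∘ h ≤ f ∘ h ∧ m ∘ h ≤ g ∘ h ∧
             ∀ k ∈ Delta P, k ≤ f ∘ h → k ≤ g ∘ h → k ≤ m ∘ h)) ∧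
       (IsGreatest (Delta Q) (fun _ : Q => (1 : unitInterval)) →
         IsGreatest (Delta P) ((fun _ : Q => (1 : unitInterval)) ∘ h)))) ∧
    ((∀ a b : P, ∃ s, IsLUB {a, b} s) → (∀ a b : Q, ∃ s, IsLUB {a, b} s) →
      ∀ zP : P, IsLeast (Set.univ : Set P) zP →
      ∀ zQ : Q, IsLeast (Set.univ : Set Q) zQ →
      (∀ a b s : P, IsLUB {a, b} s → IsLUB {h a, h b} (h s)) →
      h zP = zQ →
      ∀ q : Q, ∃ p : P, h ⁻¹' Set.Iic q = Set.Iic p) := by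
  refine ⟨fun hh => ⟨monotone_of_preimage_Iic hh, fun f hf => comp_mem_Delta hh hf, ?_,
    fun h1 => ⟨comp_mem_Delta hh h1.1, fun _ _ _ => unitInterval.le_one'⟩⟩, ?_⟩
  · rintro - hQ f g m hf hg - ⟨hmf, hmg, hm⟩
    refine ⟨fun x => hmf (h x), fun x => hmg (h x), fun k _ hkf hkg x => ?_⟩
    exact (le_inf (hkf x) (hkg x)).trans
      (hm (f ⊓ g) (inf_mem_Delta_s14 hQ hf hg) inf_le_left inf_le_right (h x))
  · rintro hP - zP - zQ hzQ hh hz q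
    exact exists_preimage_Iic_eq_Iic hP hh ⟨zP, hz.trans_le (hzQ.2 (Set.mem_univ q))⟩
end

section
/- Let P and Q be finite partially ordered sets. The map Φ : Δ(P) × Δ(Q) → Δ(P × Q) defined by Φ(f_P, f_Q)(x,y) = min(f_P(x), f_Q(y)) for (x,y) ∈ P × Q is well defined (its values lie in Δ(P × Q), where P × Q carries the componentwise order), and is an isomorphism of partially ordered topological spaces: it is bijective, both it and its inverse are order-preserving, and it is a homeomorphism for the subspace topologies inherited from [0,1]^P × [0,1]^Q and [0,1]^{P×Q}. -/
/-- Two points of a linear order with bottom agree if the same elements above `⊥` lie below both. -/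
theorem eq_of_forall_bot_lt_le_iff {α : Type*} [LinearOrder α] [OrderBot α] {a b : α}
    (h : ∀ t, ⊥ < t → (t ≤ a ↔ t ≤ b)) : a = b := by
  refine eq_of_forall_le_iff fun t => ?_
  rcases (bot_le : ⊥ ≤ t).eq_or_lt with rfl | ht
  · simp
  · exact h t ht

namespace Delta

variable {P Q : Type*} [PartialOrder P] [PartialOrder Q]

theorem min_mem {f : P → unitInterval} {g : Q → unitInterval} (hf : f ∈ Delta P)
    (hg : g ∈ Delta Q) : (fun p : P × Q => min (f p.1) (g p.2)) ∈ Delta (P × Q) := by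
  intro t ht
  obtain ⟨a, ha⟩ := hf t ht
  obtain ⟨b, hb⟩ := hg t ht
  refine ⟨(a, b), ?_⟩
  rw [← Set.Iic_prod_Iic, ← ha, ← hb]
  ext p
  simp

theorem exists_eq_top {f : P → unitInterval} (hf : f ∈ Delta P) : ∃ x, f x = ⊤ := by
  obtain ⟨x, hx⟩ := hf 1 zero_lt_one
  have h : x ∈ {y : P | 1 ≤ f y} := hx ▸ Set.mem_Iic.2 le_rfl
  exact ⟨x, top_le_iff.1 h⟩

theorem sup_eq_top [Fintype P] {f : P → unitInterval} (hf : f ∈ Delta P) :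
    Finset.univ.sup f = ⊤ := by
  obtain ⟨x, hx⟩ := exists_eq_top hf
  exact top_le_iff.1 (hx ▸ Finset.le_sup (Finset.mem_univ x))

/-- The first marginal of a function on `P × Q`: the supremum over the second variable. -/
def fstMarginal [Fintype Q] (h : P × Q → unitInterval) (x : P) : unitInterval :=
  Finset.univ.sup fun y => h (x, y)

/-- The second marginal of a function on `P × Q`: the supremum over the first variable. -/
def sndMarginal [Fintype P] (h : P × Q → unitInterval) (y : Q) : unitInterval :=
  Finset.univ.sup fun x => h (x, y)

theorem le_fstMarginal_iff [Fintype Q] {h : P × Q → unitInterval} {t : unitInterval}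
    (ht : 0 < t) {a : P × Q} (ha : {p | t ≤ h p} = Set.Iic a) (x : P) :
    t ≤ fstMarginal h x ↔ x ≤ a.1 := by
  have hmem : ∀ p, t ≤ h p ↔ p ≤ a := Set.ext_iff.1 ha
  simp only [fstMarginal, Finset.le_sup_iff (show ⊥ < t from ht), Finset.mem_univ, true_and, hmem]
  exact ⟨fun ⟨_, hy⟩ => hy.1, fun hx => ⟨a.2, hx, le_rfl⟩⟩

theorem le_sndMarginal_iff [Fintype P] {h : P × Q → unitInterval} {t : unitInterval}
    (ht : 0 < t) {a : P × Q} (ha : {p | t ≤ h p} = Set.Iic a) (y : Q) :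
    t ≤ sndMarginal h y ↔ y ≤ a.2 := by
  have hmem : ∀ p, t ≤ h p ↔ p ≤ a := Set.ext_iff.1 ha
  simp only [sndMarginal, Finset.le_sup_iff (show ⊥ < t from ht), Finset.mem_univ, true_and, hmem]
  exact ⟨fun ⟨_, hx⟩ => hx.2, fun hy => ⟨a.1, le_rfl, hy⟩⟩

theorem fstMarginal_mem [Fintype Q] {h : P × Q → unitInterval} (hh : h ∈ Delta (P × Q)) :
    fstMarginal h ∈ Delta P := fun t ht =>
  let ⟨a, ha⟩ := hh t ht
  ⟨a.1, Set.ext (le_fstMarginal_iff ht ha)⟩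

theorem sndMarginal_mem [Fintype P] {h : P × Q → unitInterval} (hh : h ∈ Delta (P × Q)) :
    sndMarginal h ∈ Delta Q := fun t ht =>
  let ⟨a, ha⟩ := hh t ht
  ⟨a.2, Set.ext (le_sndMarginal_iff ht ha)⟩

theorem fstMarginal_min {α : Type*} [Fintype Q] (f : α → unitInterval) {g : Q → unitInterval}
    (hg : g ∈ Delta Q) : fstMarginal (fun p : α × Q => min (f p.1) (g p.2)) = f := by
  funext x
  change (Finset.univ.sup fun y => f x ⊓ g y) = f x
  rw [← Finset.sup_inf_distrib_left, sup_eq_top hg, inf_top_eq]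

theorem sndMarginal_min {β : Type*} [Fintype P] {f : P → unitInterval} (hf : f ∈ Delta P)
    (g : β → unitInterval) : sndMarginal (fun p : P × β => min (f p.1) (g p.2)) = g := by
  funext y
  change (Finset.univ.sup fun x => f x ⊓ g y) = g y
  rw [← Finset.sup_inf_distrib_right, sup_eq_top hf, top_inf_eq]

theorem min_marginals [Fintype P] [Fintype Q] {h : P × Q → unitInterval}
    (hh : h ∈ Delta (P × Q)) :
    (fun p : P × Q => min (fstMarginal h p.1) (sndMarginal h p.2)) = h := by
  funext p
  refine eq_of_forall_bot_lt_le_iff fun t ht => ?_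
  obtain ⟨a, ha⟩ := hh t ht
  rw [le_min_iff, le_fstMarginal_iff ht ha, le_sndMarginal_iff ht ha]
  exact (Set.ext_iff.1 ha p).symm

/-- The bijection `Δ(P) × Δ(Q) ≃ Δ(P × Q)` given by pointwise minima, with the marginals as
inverse. -/
def prodEquiv [Fintype P] [Fintype Q] : ↥(Delta P) × ↥(Delta Q) ≃ ↥(Delta (P × Q)) where
  toFun fg := ⟨fun p => min (fg.1.1 p.1) (fg.2.1 p.2), min_mem fg.1.2 fg.2.2⟩
  invFun h := (⟨fstMarginal h.1, fstMarginal_mem h.2⟩, ⟨sndMarginal h.1, sndMarginal_mem h.2⟩)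
  left_inv fg := Prod.ext (Subtype.ext (fstMarginal_min fg.1.1 fg.2.2))
    (Subtype.ext (sndMarginal_min fg.1.2 fg.2.1))
  right_inv h := Subtype.ext (min_marginals h.2)

theorem monotone_prodEquiv [Fintype P] [Fintype Q] : Monotone (prodEquiv (P := P) (Q := Q)) :=
  fun _ _ hab p => min_le_min (hab.1 p.1) (hab.2 p.2)

theorem monotone_prodEquiv_symm [Fintype P] [Fintype Q] :
    Monotone (prodEquiv (P := P) (Q := Q)).symm := fun _ _ hab =>
  ⟨fun x => Finset.sup_mono_fun fun y _ => hab (x, y),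
    fun y => Finset.sup_mono_fun fun x _ => hab (x, y)⟩

theorem continuous_prodEquiv [Fintype P] [Fintype Q] :
    Continuous (prodEquiv (P := P) (Q := Q)) :=
  Continuous.subtype_mk (continuous_pi fun p =>
    ((continuous_apply p.1).comp (continuous_subtype_val.comp continuous_fst)).min
      ((continuous_apply p.2).comp (continuous_subtype_val.comp continuous_snd))) _

theorem continuous_prodEquiv_symm [Fintype P] [Fintype Q] :
    Continuous (prodEquiv (P := P) (Q := Q)).symm :=
  (Continuous.subtype_mk (continuous_pi fun x => Continuous.finset_sup_apply fun y _ =>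
      (continuous_apply (x, y)).comp continuous_subtype_val) _).prodMk
    (Continuous.subtype_mk (continuous_pi fun y => Continuous.finset_sup_apply fun x _ =>
      (continuous_apply (x, y)).comp continuous_subtype_val) _)

end Delta


/-- For finite posets `P` and `Q`, the map `Φ(f_P, f_Q)(x,y) = min (f_P x) (f_Q y)`
takes its values in `Δ(P × Q)` and is an isomorphism of partially ordered topological
spaces `Δ(P) × Δ(Q) ≅ Δ(P × Q)`: a bijection that is order-preserving in both
directions and a homeomorphism. -/
theorem stmt15 {P Q : Type*} [Fintype P] [Fintype Q] [PartialOrder P] [PartialOrder Q] :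
    (∀ (f : P → unitInterval) (g : Q → unitInterval), f ∈ Delta P → g ∈ Delta Q →
      (fun p : P × Q => min (f p.1) (g p.2)) ∈ Delta (P × Q)) ∧
    (∃ e : ↥(Delta P) × ↥(Delta Q) ≃ ↥(Delta (P × Q)),
      (∀ fg : ↥(Delta P) × ↥(Delta Q),
        ((e fg : (P × Q → unitInterval))) =
          fun p : P × Q => min (fg.1.1 p.1) (fg.2.1 p.2)) ∧
      (∀ a b : ↥(Delta P) × ↥(Delta Q), a ≤ b ↔ e a ≤ e b) ∧
      Continuous e ∧
      Continuous e.symm) := by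
  exact ⟨fun _ _ => Delta.min_mem, Delta.prodEquiv, fun _ => rfl,
    fun a b => ⟨fun h => Delta.monotone_prodEquiv h,
      fun h => by simpa using Delta.monotone_prodEquiv_symm h⟩,
    Delta.continuous_prodEquiv, Delta.continuous_prodEquiv_symm⟩
end

section
/- Let P be a set, (P_i)_{i∈I} a nonempty family of subsets of P with union P, and C ⊆ P a subset with P_i ∩ P_j = C for all i ≠ j. Suppose each P_i carries a partial order ≤_i, that all the orders ≤_i agree on C, that C is a chain under this common order, and that for every i ∈ I and x ∈ P_i the set {z ∈ C | x ≤_i z} has a least element u_i(x) and the set {z ∈ C | z ≤_i x} has a greatest element d_i(x). Define a relation ≤ on P by: x ≤ y iff either x, y ∈ P_i and x ≤_i y for some i, or x ∈ P_i, y ∈ P_j with i ≠ j and there exists z ∈ C with x ≤_i z ≤_j y. Then ≤ is a well-defined partial order on P whose restriction to each P_i is ≤_i. Moreover, if each (P_i, ≤_i) is a lattice, then (P, ≤) is a lattice, in which for x ∈ P_i and y ∈ P_j with i ≠ j and u_i(x) ≥ u_j(y), the join of x and y is x ∨_i u_j(y), computed in P_i, and dually for meets. -/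
/-- The stitching relation on `P = ⋃ i, Ps i`: `x ≤ y` iff either `x, y` lie in a common
piece `Ps i` and `x ≤ᵢ y`, or `x ∈ Ps i`, `y ∈ Ps j` with `i ≠ j` and `x ≤ᵢ z ≤ⱼ y` for
some `z` in the common chain `C`. -/
def stitchRel {P I : Type*} (Ps : I → Set P) (C : Set P)
    (le : I → P → P → Prop) (x y : P) : Prop :=
  (∃ i, x ∈ Ps i ∧ y ∈ Ps i ∧ le i x y) ∨
    (∃ i j, i ≠ j ∧ x ∈ Ps i ∧ y ∈ Ps j ∧ ∃ z ∈ C, le i x z ∧ le j z y)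

/-- The data for stitching posets along a chain: pieces `Ps i` covering `P` and meeting pairwise
in the chain `C`, with partial orders agreeing on `C`, such that every element of a piece has a
least upper and a greatest lower approximation in `C`. -/
structure IsStitching {P I : Type*} (Ps : I → Set P) (C : Set P) (le : I → P → P → Prop) :
    Prop where
  exists_mem : ∀ x, ∃ i, x ∈ Ps i
  subset : ∀ i, C ⊆ Ps i
  mem_chain : ∀ {i j x}, i ≠ j → x ∈ Ps i → x ∈ Ps j → x ∈ C
  refl : ∀ i, ∀ x ∈ Ps i, le i x x
  antisymm : ∀ i, ∀ x ∈ Ps i, ∀ y ∈ Ps i, le i x y → le i y x → x = y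
  trans : ∀ i, ∀ x ∈ Ps i, ∀ y ∈ Ps i, ∀ z ∈ Ps i, le i x y → le i y z → le i x z
  agree : ∀ i j, ∀ x ∈ C, ∀ y ∈ C, (le i x y ↔ le j x y)
  chain : ∀ i, ∀ x ∈ C, ∀ y ∈ C, le i x y ∨ le i y x
  up : ∀ i, ∀ x ∈ Ps i, ∃ u ∈ C, le i x u ∧ ∀ z ∈ C, le i x z → le i u z
  down : ∀ i, ∀ x ∈ Ps i, ∃ d ∈ C, le i d x ∧ ∀ z ∈ C, le i z x → le i z d

theorem stitchRel_swap {P I : Type*} (Ps : I → Set P) (C : Set P) (le : I → P → P → Prop)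
    (x y : P) : stitchRel Ps C (fun i => Function.swap (le i)) x y ↔ stitchRel Ps C le y x := by
  simp only [stitchRel, Function.swap]
  constructor
  · rintro (⟨i, hx, hy, h⟩ | ⟨i, j, hij, hx, hy, z, hz, h₁, h₂⟩)
    · exact Or.inl ⟨i, hy, hx, h⟩
    · exact Or.inr ⟨j, i, hij.symm, hy, hx, z, hz, h₂, h₁⟩
  · rintro (⟨i, hx, hy, h⟩ | ⟨i, j, hij, hx, hy, z, hz, h₁, h₂⟩)
    · exact Or.inl ⟨i, hy, hx, h⟩
    · exact Or.inr ⟨j, i, hij.symm, hy, hx, z, hz, h₂, h₁⟩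

namespace IsStitching

variable {P I : Type*} {Ps : I → Set P} {C : Set P} {le : I → P → P → Prop}

theorem swap (h : IsStitching Ps C le) : IsStitching Ps C (fun i => Function.swap (le i)) where
  exists_mem := h.exists_mem
  subset := h.subset
  mem_chain := h.mem_chain
  refl := h.refl
  antisymm i x hx y hy hxy hyx := h.antisymm i x hx y hy hyx hxy
  trans i x hx y hy z hz hxy hyz := h.trans i z hz y hy x hx hyz hxy
  agree i j x hx y hy := h.agree i j y hy x hx
  chain i x hx y hy := h.chain i y hy x hx
  up := h.down
  down := h.up

theorem le_chain_transfer (h : IsStitching Ps C le) {i j : I} {x z : P} (hi : x ∈ Ps i)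
    (hj : x ∈ Ps j) (hz : z ∈ C) (hxz : le i x z) : le j x z := by
  by_cases hij : i = j
  · exact hij ▸ hxz
  · exact (h.agree i j x (h.mem_chain hij hi hj) z hz).1 hxz

theorem chain_le_transfer (h : IsStitching Ps C le) {i j : I} {x z : P} (hi : x ∈ Ps i)
    (hj : x ∈ Ps j) (hz : z ∈ C) (hzx : le i z x) : le j z x :=
  h.swap.le_chain_transfer hi hj hz hzx

theorem rel_of_le {i : I} {x y : P} (hx : x ∈ Ps i) (hy : y ∈ Ps i) (hxy : le i x y) :
    stitchRel Ps C le x y :=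
  Or.inl ⟨i, hx, hy, hxy⟩

theorem rel_of_le_of_le (h : IsStitching Ps C le) {i j : I} {x y z : P} (hx : x ∈ Ps i)
    (hy : y ∈ Ps j) (hz : z ∈ C) (hxz : le i x z) (hzy : le j z y) : stitchRel Ps C le x y := by
  by_cases hij : i = j
  · subst hij
    exact rel_of_le hx hy (h.trans i x hx z (h.subset i hz) y hy hxz hzy)
  · exact Or.inr ⟨i, j, hij, hx, hy, z, hz, hxz, hzy⟩

theorem rel_iff_le (h : IsStitching Ps C le) {i : I} {x y : P} (hx : x ∈ Ps i) (hy : y ∈ Ps i) :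
    stitchRel Ps C le x y ↔ le i x y := by
  refine ⟨?_, rel_of_le hx hy⟩
  rintro (⟨j, hxj, hyj, hxy⟩ | ⟨a, b, -, hxa, hyb, z, hz, hxz, hzy⟩)
  · by_cases hij : j = i
    · exact hij ▸ hxy
    · exact h.le_chain_transfer hxj hx (h.mem_chain hij hyj hy) hxy
  · exact h.trans i x hx z (h.subset i hz) y hy (h.le_chain_transfer hxa hx hz hxz)
      (h.chain_le_transfer hyb hy hz hzy)

theorem exists_between (h : IsStitching Ps C le) {i j : I} {x y : P} (hij : i ≠ j)
    (hx : x ∈ Ps i) (hy : y ∈ Ps j) (hxy : stitchRel Ps C le x y) :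
    ∃ z ∈ C, le i x z ∧ le j z y := by
  obtain ⟨k, hxk, hyk, hk⟩ | ⟨a, b, -, hxa, hyb, z, hz, hxz, hzy⟩ := hxy
  · by_cases hki : k = i
    · subst hki
      exact ⟨y, h.mem_chain hij hyk hy, hk, h.refl j y hy⟩
    · have hxC := h.mem_chain hki hxk hx
      exact ⟨x, hxC, h.refl i x hx, h.chain_le_transfer hyk hy hxC hk⟩
  · exact ⟨z, hz, h.le_chain_transfer hxa hx hz hxz, h.chain_le_transfer hyb hy hz hzy⟩

theorem rel_refl (h : IsStitching Ps C le) (x : P) : stitchRel Ps C le x x :=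
  let ⟨i, hi⟩ := h.exists_mem x
  rel_of_le hi hi (h.refl i x hi)

theorem rel_trans (h : IsStitching Ps C le) {x y z : P} (hxy : stitchRel Ps C le x y)
    (hyz : stitchRel Ps C le y z) : stitchRel Ps C le x z := by
  obtain ⟨i, hx⟩ := h.exists_mem x
  obtain ⟨j, hy⟩ := h.exists_mem y
  obtain ⟨k, hz⟩ := h.exists_mem z
  by_cases hij : i = j
  · subst hij
    rw [h.rel_iff_le hx hy] at hxy
    by_cases hik : i = k
    · subst hik
      rw [h.rel_iff_le hy hz] at hyz
      exact rel_of_le hx hz (h.trans i x hx y hy z hz hxy hyz)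
    · obtain ⟨c, hc, hyc, hcz⟩ := h.exists_between hik hy hz hyz
      exact h.rel_of_le_of_le hx hz hc (h.trans i x hx y hy c (h.subset i hc) hxy hyc) hcz
  · obtain ⟨c, hc, hxc, hcy⟩ := h.exists_between hij hx hy hxy
    by_cases hjk : j = k
    · subst hjk
      rw [h.rel_iff_le hy hz] at hyz
      exact h.rel_of_le_of_le hx hz hc hxc (h.trans j c (h.subset j hc) y hy z hz hcy hyz)
    · obtain ⟨d, hd, hyd, hdz⟩ := h.exists_between hjk hy hz hyz
      have hcd : le i c d := (h.agree j i c hc d hd).1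
        (h.trans j c (h.subset j hc) y hy d (h.subset j hd) hcy hyd)
      exact h.rel_of_le_of_le hx hz hd
        (h.trans i x hx c (h.subset i hc) d (h.subset i hd) hxc hcd) hdz

theorem rel_antisymm (h : IsStitching Ps C le) {x y : P} (hxy : stitchRel Ps C le x y)
    (hyx : stitchRel Ps C le y x) : x = y := by
  obtain ⟨i, hx⟩ := h.exists_mem x
  obtain ⟨j, hy⟩ := h.exists_mem y
  by_cases hij : i = j
  · subst hij
    exact h.antisymm i x hx y hy ((h.rel_iff_le hx hy).1 hxy) ((h.rel_iff_le hy hx).1 hyx)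
  · obtain ⟨c, hc, hxc, hcy⟩ := h.exists_between hij hx hy hxy
    have hcx : le i c x :=
      (h.rel_iff_le (h.subset i hc) hx).1 (h.rel_trans (rel_of_le (h.subset j hc) hy hcy) hyx)
    obtain rfl := h.antisymm i x hx c (h.subset i hc) hxc hcx
    exact h.antisymm j x (h.subset j hc) y hy hcy ((h.rel_iff_le hy (h.subset j hc)).1 hyx)

/-- The least upper approximation of `x` in `C` lies below every `w` above `x` that belongs to
another piece or to `C`. -/
theorem up_rel (h : IsStitching Ps C le) {i k : I} {x u w : P} (hik : i ≠ k) (hx : x ∈ Ps i)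
    (hu : u ∈ C) (hmin : ∀ z ∈ C, le i x z → le i u z) (hw : w ∈ Ps k)
    (hxw : stitchRel Ps C le x w) : stitchRel Ps C le u w := by
  obtain ⟨z, hz, hxz, hzw⟩ := h.exists_between hik hx hw hxw
  exact h.rel_of_le_of_le (h.subset i hu) hw hz (hmin z hz hxz) hzw

theorem isJoin_of_ne (h : IsStitching Ps C le) {i j : I} (hij : i ≠ j) {x y ux uy s : P}
    (hx : x ∈ Ps i) (hy : y ∈ Ps j) (hux : ux ∈ C) (hxux : le i x ux)
    (hxmin : ∀ z ∈ C, le i x z → le i ux z) (huy : uy ∈ C) (hyuy : le j y uy)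
    (hymin : ∀ z ∈ C, le j y z → le j uy z) (hle : le i uy ux) (hs : s ∈ Ps i)
    (hxs : le i x s) (huys : le i uy s)
    (hsmin : ∀ w ∈ Ps i, le i x w → le i uy w → le i s w) :
    stitchRel Ps C le x s ∧ stitchRel Ps C le y s ∧
      ∀ w, stitchRel Ps C le x w → stitchRel Ps C le y w → stitchRel Ps C le s w := by
  refine ⟨rel_of_le hx hs hxs, h.rel_of_le_of_le hy hs huy hyuy huys, fun w hxw hyw => ?_⟩
  obtain ⟨k, hw⟩ := h.exists_mem w
  by_cases hik : i = k
  · subst hik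
    have huyw := h.up_rel hij.symm hy huy hymin hw hyw
    exact rel_of_le hs hw (hsmin w hw ((h.rel_iff_le hx hw).1 hxw)
      ((h.rel_iff_le (h.subset i huy) hw).1 huyw))
  · exact h.rel_trans (rel_of_le hs (h.subset i hux) (hsmin ux (h.subset i hux) hxux hle))
      (h.up_rel hik hx hux hxmin hw hxw)

theorem isJoin_of_mem (h : IsStitching Ps C le) {i : I} {x y s : P}
    (hx : x ∈ Ps i) (hy : y ∈ Ps i) (hs : s ∈ Ps i) (hxs : le i x s) (hys : le i y s)
    (hsmin : ∀ w ∈ Ps i, le i x w → le i y w → le i s w) :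
    stitchRel Ps C le x s ∧ stitchRel Ps C le y s ∧
      ∀ w, stitchRel Ps C le x w → stitchRel Ps C le y w → stitchRel Ps C le s w := by
  refine ⟨rel_of_le hx hs hxs, rel_of_le hy hs hys, fun w hxw hyw => ?_⟩
  obtain ⟨k, hw⟩ := h.exists_mem w
  by_cases hik : i = k
  · subst hik
    exact rel_of_le hs hw
      (hsmin w hw ((h.rel_iff_le hx hw).1 hxw) ((h.rel_iff_le hy hw).1 hyw))
  · obtain ⟨a, ha, hxa, haw⟩ := h.exists_between hik hx hw hxw
    obtain ⟨b, hb, hyb, hbw⟩ := h.exists_between hik hy hw hyw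
    have hai := h.subset i ha
    have hbi := h.subset i hb
    obtain hab | hba := h.chain i a ha b hb
    · exact h.rel_of_le_of_le hs hw hb (hsmin b hbi (h.trans i x hx a hai b hbi hxa hab) hyb) hbw
    · exact h.rel_of_le_of_le hs hw ha (hsmin a hai hxa (h.trans i y hy b hbi a hai hyb hba)) haw

theorem exists_join (h : IsStitching Ps C le)
    (hjoin : ∀ i, ∀ x ∈ Ps i, ∀ y ∈ Ps i, ∃ s ∈ Ps i, le i x s ∧ le i y s ∧
      ∀ w ∈ Ps i, le i x w → le i y w → le i s w) (x y : P) :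
    ∃ s, stitchRel Ps C le x s ∧ stitchRel Ps C le y s ∧
      ∀ w, stitchRel Ps C le x w → stitchRel Ps C le y w → stitchRel Ps C le s w := by
  obtain ⟨i, hx⟩ := h.exists_mem x
  obtain ⟨j, hy⟩ := h.exists_mem y
  by_cases hij : i = j
  · subst hij
    obtain ⟨s, hs, hxs, hys, hsmin⟩ := hjoin i x hx y hy
    exact ⟨s, h.isJoin_of_mem hx hy hs hxs hys hsmin⟩
  · obtain ⟨a, ha, hxa, hamin⟩ := h.up i x hx
    obtain ⟨b, hb, hyb, hbmin⟩ := h.up j y hy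
    obtain hab | hba := h.chain j a ha b hb
    · obtain ⟨s, hs, hys, has, hsmin⟩ := hjoin j y hy a (h.subset j ha)
      obtain ⟨h₁, h₂, h₃⟩ := h.isJoin_of_ne (Ne.symm hij) hy hx hb hyb hbmin ha hxa hamin hab hs
        hys has hsmin
      exact ⟨s, h₂, h₁, fun w hxw hyw => h₃ w hyw hxw⟩
    · obtain ⟨s, hs, hxs, hbs, hsmin⟩ := hjoin i x hx b (h.subset i hb)
      exact ⟨s, h.isJoin_of_ne hij hx hy ha hxa hamin hb hyb hbmin
        ((h.agree j i b hb a ha).1 hba) hs hxs hbs hsmin⟩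

end IsStitching

/-- Stitching posets together along a chain.  Let `(Ps i)` be a nonempty family of
subsets covering `P`, pairwise intersecting in a common subset `C` of each piece, each
equipped with a partial order `le i`; suppose the orders agree on `C`, `C` is a chain,
and each `x ∈ Ps i` has a least upper bound `u_i x` and a greatest lower bound `d_i x`
in `C`.  Then `stitchRel` is a partial order on `P` restricting to `le i` on each
`Ps i`; and if each piece is a lattice, `P` is a lattice in which, for `x ∈ Ps i`,
`y ∈ Ps j`, `i ≠ j`, and `u_j y ≤ u_i x`, the join of `x` and `y` is the join
`x ∨ᵢ (u_j y)` computed in `Ps i`, and dually for meets. -/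
theorem stmt16 {P I : Type*} [Nonempty I]
    (Ps : I → Set P) (C : Set P) (le : I → P → P → Prop)
    (hunion : (⋃ i, Ps i) = Set.univ)
    (hC : ∀ i, C ⊆ Ps i)
    (hinter : ∀ i j, i ≠ j → Ps i ∩ Ps j = C)
    (hrefl : ∀ i, ∀ x ∈ Ps i, le i x x)
    (hantisymm : ∀ i, ∀ x ∈ Ps i, ∀ y ∈ Ps i, le i x y → le i y x → x = y)
    (htrans : ∀ i, ∀ x ∈ Ps i, ∀ y ∈ Ps i, ∀ z ∈ Ps i,
      le i x y → le i y z → le i x z)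
    (hagree : ∀ i j, ∀ x ∈ C, ∀ y ∈ C, (le i x y ↔ le j x y))
    (hchain : ∀ i, ∀ x ∈ C, ∀ y ∈ C, le i x y ∨ le i y x)
    (hu : ∀ i, ∀ x ∈ Ps i, ∃ u ∈ C, le i x u ∧ ∀ z ∈ C, le i x z → le i u z)
    (hd : ∀ i, ∀ x ∈ Ps i, ∃ d ∈ C, le i d x ∧ ∀ z ∈ C, le i z x → le i z d) :
    (∀ x : P, stitchRel Ps C le x x) ∧
    (∀ x y : P, stitchRel Ps C le x y → stitchRel Ps C le y x → x = y) ∧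
    (∀ x y z : P, stitchRel Ps C le x y → stitchRel Ps C le y z →
      stitchRel Ps C le x z) ∧
    (∀ i, ∀ x ∈ Ps i, ∀ y ∈ Ps i, (stitchRel Ps C le x y ↔ le i x y)) ∧
    ((∀ i, ∀ x ∈ Ps i, ∀ y ∈ Ps i,
        (∃ s ∈ Ps i, le i x s ∧ le i y s ∧
          ∀ w ∈ Ps i, le i x w → le i y w → le i s w) ∧
        (∃ m ∈ Ps i, le i m x ∧ le i m y ∧
          ∀ w ∈ Ps i, le i w x → le i w y → le i w m)) →
      ((∀ x y : P, ∃ s : P,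
          stitchRel Ps C le x s ∧ stitchRel Ps C le y s ∧
            ∀ w : P, stitchRel Ps C le x w → stitchRel Ps C le y w →
              stitchRel Ps C le s w) ∧
       (∀ x y : P, ∃ m : P,
          stitchRel Ps C le m x ∧ stitchRel Ps C le m y ∧
            ∀ w : P, stitchRel Ps C le w x → stitchRel Ps C le w y →
              stitchRel Ps C le w m) ∧
       (∀ i j, i ≠ j → ∀ x ∈ Ps i, ∀ y ∈ Ps j,
          ∀ ux ∈ C, (le i x ux ∧ ∀ z ∈ C, le i x z → le i ux z) →
          ∀ uy ∈ C, (le j y uy ∧ ∀ z ∈ C, le j y z → le j uy z) →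
          le i uy ux →
          ∀ s ∈ Ps i, (le i x s ∧ le i uy s ∧
              ∀ w ∈ Ps i, le i x w → le i uy w → le i s w) →
            (stitchRel Ps C le x s ∧ stitchRel Ps C le y s ∧
              ∀ w : P, stitchRel Ps C le x w → stitchRel Ps C le y w →
                stitchRel Ps C le s w)) ∧
       (∀ i j, i ≠ j → ∀ x ∈ Ps i, ∀ y ∈ Ps j,
          ∀ dx ∈ C, (le i dx x ∧ ∀ z ∈ C, le i z x → le i z dx) →
          ∀ dy ∈ C, (le j dy y ∧ ∀ z ∈ C, le j z y → le j z dy) →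
          le i dx dy →
          ∀ m ∈ Ps i, (le i m x ∧ le i m dy ∧
              ∀ w ∈ Ps i, le i w x → le i w dy → le i w m) →
            (stitchRel Ps C le m x ∧ stitchRel Ps C le m y ∧
              ∀ w : P, stitchRel Ps C le w x → stitchRel Ps C le w y →
                stitchRel Ps C le w m)))) := by
  have h : IsStitching Ps C le :=
    { exists_mem := fun x => Set.mem_iUnion.1 (hunion ▸ Set.mem_univ x)
      subset := hC
      mem_chain := fun hij hi hj => hinter _ _ hij ▸ ⟨hi, hj⟩
      refl := hrefl
      antisymm := hantisymm
      trans := htrans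
      agree := hagree
      chain := hchain
      up := hu
      down := hd }
  refine ⟨h.rel_refl, fun _ _ => h.rel_antisymm, fun _ _ _ => h.rel_trans,
    fun i x hx y hy => h.rel_iff_le hx hy, fun hlat => ⟨?_, ?_, ?_, ?_⟩⟩
  · exact h.exists_join fun i x hx y hy => (hlat i x hx y hy).1
  · have hmeet := h.swap.exists_join fun i x hx y hy => (hlat i x hx y hy).2
    simpa only [stitchRel_swap] using hmeet
  · rintro i j hij x hx y hy ux hux ⟨hxux, hxmin⟩ uy huy ⟨hyuy, hymin⟩ hle s hs ⟨hxs, huys, hsmin⟩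
    exact h.isJoin_of_ne hij hx hy hux hxux hxmin huy hyuy hymin hle hs hxs huys hsmin
  · rintro i j hij x hx y hy dx hdx ⟨hdxx, hxmax⟩ dy hdy ⟨hdyy, hymax⟩ hle m hm ⟨hmx, hmdy, hmmax⟩
    have hmeet := h.swap.isJoin_of_ne hij hx hy hdx hdxx hxmax hdy hdyy hymax hle hm hmx hmdy hmmax
    simpa only [stitchRel_swap] using hmeet
end

section
/- Let L and M be topological lattices (Hausdorff spaces with lattice structures whose binary meet and join are continuous), and let a, b : L → M be continuous order-preserving maps (not assumed to be lattice homomorphisms) with a(x) ≤ b(x) for all x ∈ L. Let E = {(x,y) ∈ L × M | a(x) ≤ y ≤ b(x)}, partially ordered componentwise. Then E is a lattice in which the least upper bound of (x,y) and (x',y') is (x ∨ x', y ∨ y' ∨ a(x ∨ x')) and the greatest lower bound is (x ∧ x', y ∧ y' ∧ b(x ∧ x')); with the subspace topology from L × M, these two operations on E are continuous, so E is a topological lattice. -/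
/-- Edmondson's set `E(L,M;a,b) = {(x,y) ∈ L × M | a x ≤ y ≤ b x}`. -/
def Edm {L M : Type*} [Preorder L] [Preorder M] (a b : L → M) : Set (L × M) :=
  {p | a p.1 ≤ p.2 ∧ p.2 ≤ b p.1}

namespace Edm

variable {L M : Type*} [Lattice L] [Lattice M] {a b : L → M}

theorem sup_mem (hmb : Monotone b) (hab : ∀ x : L, a x ≤ b x) {p q : L × M}
    (hp : p ∈ Edm a b) (hq : q ∈ Edm a b) :
    (p.1 ⊔ q.1, p.2 ⊔ q.2 ⊔ a (p.1 ⊔ q.1)) ∈ Edm a b :=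
  ⟨le_sup_right, sup_le (sup_le (hp.2.trans (hmb le_sup_left)) (hq.2.trans (hmb le_sup_right)))
    (hab _)⟩

theorem inf_mem (hma : Monotone a) (hab : ∀ x : L, a x ≤ b x) {p q : L × M}
    (hp : p ∈ Edm a b) (hq : q ∈ Edm a b) :
    (p.1 ⊓ q.1, p.2 ⊓ q.2 ⊓ b (p.1 ⊓ q.1)) ∈ Edm a b :=
  ⟨le_inf (le_inf ((hma inf_le_left).trans hp.1) ((hma inf_le_right).trans hq.1)) (hab _),
    inf_le_right⟩

theorem isLUB_pair (hma : Monotone a) {p q r : ↥(Edm a b)}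
    (hr : (r : L × M) = (p.1.1 ⊔ q.1.1, p.1.2 ⊔ q.1.2 ⊔ a (p.1.1 ⊔ q.1.1))) :
    IsLUB {p, q} r := by
  simp only [isLUB_iff_le_iff, mem_upperBounds, Set.mem_insert_iff, Set.mem_singleton_iff,
    forall_eq_or_imp, forall_eq, ← Subtype.coe_le_coe, hr, Prod.le_def, sup_le_iff]
  exact fun s => ⟨fun h => ⟨⟨h.1.1, h.2.1.1⟩, h.1.2, h.2.1.2⟩, fun h =>
    ⟨⟨h.1.1, h.2.1⟩, ⟨h.1.2, h.2.2⟩, (hma (sup_le h.1.1 h.2.1)).trans s.2.1⟩⟩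

theorem isGLB_pair (hmb : Monotone b) {p q r : ↥(Edm a b)}
    (hr : (r : L × M) = (p.1.1 ⊓ q.1.1, p.1.2 ⊓ q.1.2 ⊓ b (p.1.1 ⊓ q.1.1))) :
    IsGLB {p, q} r := by
  simp only [isGLB_iff_le_iff, mem_lowerBounds, Set.mem_insert_iff, Set.mem_singleton_iff,
    forall_eq_or_imp, forall_eq, ← Subtype.coe_le_coe, hr, Prod.le_def, le_inf_iff]
  exact fun s => ⟨fun h => ⟨⟨h.1.1, h.2.1.1⟩, h.1.2, h.2.1.2⟩, fun h =>
    ⟨⟨h.1.1, h.2.1⟩, ⟨h.1.2, h.2.2⟩, s.2.2.trans (hmb (le_inf h.1.1 h.2.1))⟩⟩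

end Edm

/-- Let `L`, `M` be topological lattices and `a, b : L → M` continuous order-preserving
maps with `a ≤ b` pointwise.  Then `E = {(x,y) | a x ≤ y ≤ b x}`, ordered componentwise
and given the subspace topology from `L × M`, is a topological lattice with
`(x,y) ∨ (x',y') = (x ⊔ x', y ⊔ y' ⊔ a (x ⊔ x'))` and
`(x,y) ∧ (x',y') = (x ⊓ x', y ⊓ y' ⊓ b (x ⊓ x'))`, both operations being continuous. -/
theorem stmt17 {L M : Type*}
    [TopologicalSpace L] [T2Space L] [Lattice L] [TopologicalLattice L]
    [TopologicalSpace M] [T2Space M] [Lattice M] [TopologicalLattice M]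
    (a b : L → M) (ha : Continuous a) (hb : Continuous b)
    (hma : Monotone a) (hmb : Monotone b) (hab : ∀ x : L, a x ≤ b x) :
    ∃ jE mE : ↥(Edm a b) → ↥(Edm a b) → ↥(Edm a b),
      (∀ p q : ↥(Edm a b), IsLUB {p, q} (jE p q)) ∧
      (∀ p q : ↥(Edm a b), IsGLB {p, q} (mE p q)) ∧
      (∀ p q : ↥(Edm a b),
        (jE p q : L × M) =
          (p.1.1 ⊔ q.1.1, p.1.2 ⊔ q.1.2 ⊔ a (p.1.1 ⊔ q.1.1))) ∧
      (∀ p q : ↥(Edm a b),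
        (mE p q : L × M) =
          (p.1.1 ⊓ q.1.1, p.1.2 ⊓ q.1.2 ⊓ b (p.1.1 ⊓ q.1.1))) ∧
      Continuous (fun pq : ↥(Edm a b) × ↥(Edm a b) => jE pq.1 pq.2) ∧
      Continuous (fun pq : ↥(Edm a b) × ↥(Edm a b) => mE pq.1 pq.2) := by
  refine ⟨fun p q => ⟨_, Edm.sup_mem hmb hab p.2 q.2⟩, fun p q => ⟨_, Edm.inf_mem hma hab p.2 q.2⟩,
    fun _ _ => Edm.isLUB_pair hma rfl, fun _ _ => Edm.isGLB_pair hmb rfl,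
    fun _ _ => rfl, fun _ _ => rfl, ?_, ?_⟩ <;>
  · apply Continuous.subtype_mk
    fun_prop
end

section
/- Let L and M be lattices, a, b : L → M order-preserving maps with a(x) ≤ b(x) for all x ∈ L, and let E = {(x,y) ∈ L × M | a(x) ≤ y ≤ b(x)} be the lattice ordered componentwise, with join (x,y) ∨ (x',y') = (x ∨ x', y ∨ y' ∨ a(x ∨ x')) and meet (x,y) ∧ (x',y') = (x ∧ x', y ∧ y' ∧ b(x ∧ x')). Suppose x, x' ∈ L satisfy a(x) ∨ a(x') < a(x ∨ x') ∧ b(x). Then the three elements e₁ = (x, a(x) ∨ a(x')), e₂ = (x, a(x ∨ x') ∧ b(x)), e₃ = (x', a(x')) of E satisfy e₁ < e₂, e₁ ∧ e₃ = e₂ ∧ e₃ = (x ∧ x', a(x') ∧ b(x ∧ x')), and e₁ ∨ e₃ = e₂ ∨ e₃ = (x ∨ x', a(x ∨ x')); consequently the sublattice of E generated by e₁, e₂, e₃ is isomorphic to the five-element pentagon lattice N₅. -/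
/-- The join operation of the lattice `E(L,M;a,b)`. -/
def edmJoin {L M : Type*} [Lattice L] [Lattice M] (a : L → M) (p q : L × M) : L × M :=
  (p.1 ⊔ q.1, p.2 ⊔ q.2 ⊔ a (p.1 ⊔ q.1))

/-- The meet operation of the lattice `E(L,M;a,b)`. -/
def edmMeet {L M : Type*} [Lattice L] [Lattice M] (b : L → M) (p q : L × M) : L × M :=
  (p.1 ⊓ q.1, p.2 ⊓ q.2 ⊓ b (p.1 ⊓ q.1))

section EdmLattice

variable {L M : Type*} [Lattice L] [Lattice M] {a b : L → M} {p q : L × M}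

theorem edmJoin_comm (a : L → M) (p q : L × M) : edmJoin a p q = edmJoin a q p := by
  simp only [edmJoin, sup_comm]

theorem edmMeet_comm (b : L → M) (p q : L × M) : edmMeet b p q = edmMeet b q p := by
  simp only [edmMeet, inf_comm]

theorem edmJoin_eq_right (hq : q ∈ Edm a b) (h : p ≤ q) : edmJoin a p q = q := by
  ext
  · exact sup_eq_right.2 h.1
  · simp only [edmJoin, sup_eq_right.2 h.1, sup_eq_right.2 h.2, sup_eq_left.2 hq.1]

theorem edmMeet_eq_left (hp : p ∈ Edm a b) (h : p ≤ q) : edmMeet b p q = p := by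
  ext
  · exact inf_eq_left.2 h.1
  · simp only [edmMeet, inf_eq_left.2 h.1, inf_eq_left.2 h.2, inf_eq_left.2 hp.2]

/-- Five elements of `E` in the shape of a pentagon, whose two incomparable pairs have the bottom
element as meet and the top element as join, are closed under the operations of `E`. -/
theorem edmJoin_mem_and_edmMeet_mem_of_pentagon {m e₁ e₂ e₃ j : L × M}
    (hE : ∀ u ∈ ({m, e₁, e₂, e₃, j} : Set (L × M)), u ∈ Edm a b)
    (hm₁ : m ≤ e₁) (h₁₂ : e₁ ≤ e₂) (h₂j : e₂ ≤ j) (hm₃ : m ≤ e₃) (h₃j : e₃ ≤ j)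
    (meet₁ : edmMeet b e₁ e₃ = m) (meet₂ : edmMeet b e₂ e₃ = m)
    (join₁ : edmJoin a e₁ e₃ = j) (join₂ : edmJoin a e₂ e₃ = j)
    (u : L × M) (hu : u ∈ ({m, e₁, e₂, e₃, j} : Set (L × M)))
    (v : L × M) (hv : v ∈ ({m, e₁, e₂, e₃, j} : Set (L × M))) :
    edmJoin a u v ∈ ({m, e₁, e₂, e₃, j} : Set (L × M)) ∧
      edmMeet b u v ∈ ({m, e₁, e₂, e₃, j} : Set (L × M)) := by
  have hm₂ := hm₁.trans h₁₂
  have h₁j := h₁₂.trans h₂j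
  have hmj := hm₃.trans h₃j
  by_cases h : u ≤ v ∨ v ≤ u
  · rcases h with h | h
    · rw [edmJoin_eq_right (hE v hv) h, edmMeet_eq_left (hE u hu) h]
      exact ⟨hv, hu⟩
    · rw [edmJoin_comm, edmMeet_comm, edmJoin_eq_right (hE u hu) h, edmMeet_eq_left (hE v hv) h]
      exact ⟨hu, hv⟩
  · have meet₁' := (edmMeet_comm b e₃ e₁).trans meet₁
    have meet₂' := (edmMeet_comm b e₃ e₂).trans meet₂
    have join₁' := (edmJoin_comm a e₃ e₁).trans join₁
    have join₂' := (edmJoin_comm a e₃ e₂).trans join₂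
    simp only [Set.mem_insert_iff, Set.mem_singleton_iff] at hu hv
    rcases hu with rfl | rfl | rfl | rfl | rfl <;> rcases hv with rfl | rfl | rfl | rfl | rfl <;>
      simp_all

end EdmLattice

/-- Let `L`, `M` be lattices, `a b : L → M` order-preserving with `a ≤ b` pointwise,
and `E = {(x,y) | a x ≤ y ≤ b x}` with the componentwise order and the join and meet
operations above.  If `a x ⊔ a x' < a (x ⊔ x') ⊓ b x`, then the elements
`e₁ = (x, a x ⊔ a x')`, `e₂ = (x, a (x ⊔ x') ⊓ b x)`, `e₃ = (x', a x')` of `E` satisfy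
`e₁ < e₂`, have equal meets and equal joins with `e₃`, and together with
`m = e₁ ∧ e₃` and `j = e₁ ∨ e₃` form a five-element sublattice of `E` isomorphic to
the pentagon `N₅`. -/
theorem stmt18 {L M : Type*} [Lattice L] [Lattice M]
    (a b : L → M) (hma : Monotone a) (hmb : Monotone b) (hab : ∀ x : L, a x ≤ b x)
    (x x' : L) (hx : a x ⊔ a x' < a (x ⊔ x') ⊓ b x) :
    (x, a x ⊔ a x') ∈ Edm a b ∧
    (x, a (x ⊔ x') ⊓ b x) ∈ Edm a b ∧
    (x', a x') ∈ Edm a b ∧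
    ((x, a x ⊔ a x') : L × M) < (x, a (x ⊔ x') ⊓ b x) ∧
    edmMeet b (x, a x ⊔ a x') (x', a x') = (x ⊓ x', a x' ⊓ b (x ⊓ x')) ∧
    edmMeet b (x, a (x ⊔ x') ⊓ b x) (x', a x') = (x ⊓ x', a x' ⊓ b (x ⊓ x')) ∧
    edmJoin a (x, a x ⊔ a x') (x', a x') = (x ⊔ x', a (x ⊔ x')) ∧
    edmJoin a (x, a (x ⊔ x') ⊓ b x) (x', a x') = (x ⊔ x', a (x ⊔ x')) ∧
    -- the five elements form a sublattice of `E` with the order structure of `N₅`: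
    (((x ⊓ x', a x' ⊓ b (x ⊓ x')) : L × M) < (x, a x ⊔ a x')) ∧
    (((x, a (x ⊔ x') ⊓ b x) : L × M) < (x ⊔ x', a (x ⊔ x'))) ∧
    (((x ⊓ x', a x' ⊓ b (x ⊓ x')) : L × M) < (x', a x')) ∧
    (((x', a x') : L × M) < (x ⊔ x', a (x ⊔ x'))) ∧
    ¬ (((x, a x ⊔ a x') : L × M) ≤ (x', a x')) ∧
    ¬ (((x', a x') : L × M) ≤ (x, a x ⊔ a x')) ∧
    ¬ (((x, a (x ⊔ x') ⊓ b x) : L × M) ≤ (x', a x')) ∧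
    ¬ (((x', a x') : L × M) ≤ (x, a (x ⊔ x') ⊓ b x)) ∧
    (∀ u ∈ ({(x ⊓ x', a x' ⊓ b (x ⊓ x')), (x, a x ⊔ a x'), (x, a (x ⊔ x') ⊓ b x),
        (x', a x'), (x ⊔ x', a (x ⊔ x'))} : Set (L × M)),
      ∀ v ∈ ({(x ⊓ x', a x' ⊓ b (x ⊓ x')), (x, a x ⊔ a x'), (x, a (x ⊔ x') ⊓ b x),
          (x', a x'), (x ⊔ x', a (x ⊔ x'))} : Set (L × M)),
        edmJoin a u v ∈ ({(x ⊓ x', a x' ⊓ b (x ⊓ x')), (x, a x ⊔ a x'),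
            (x, a (x ⊔ x') ⊓ b x), (x', a x'), (x ⊔ x', a (x ⊔ x'))} : Set (L × M)) ∧
        edmMeet b u v ∈ ({(x ⊓ x', a x' ⊓ b (x ⊓ x')), (x, a x ⊔ a x'),
            (x, a (x ⊔ x') ⊓ b x), (x', a x'), (x ⊔ x', a (x ⊔ x'))} : Set (L × M))) := by
  have hnle : ¬ x ≤ x' := fun h => by
    rw [sup_eq_right.2 h] at hx
    exact (hx.trans_le inf_le_left).not_ge le_sup_right
  have hnle' : ¬ x' ≤ x := fun h => by
    rw [sup_eq_left.2 h] at hx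
    exact (hx.trans_le inf_le_left).not_ge le_sup_left
  have hsup : a x ⊔ a x' ≤ a (x ⊔ x') := hx.le.trans inf_le_left
  have ha' : a x' ≤ a (x ⊔ x') ⊓ b x := le_sup_right.trans hx.le
  have mem₁ : (x, a x ⊔ a x') ∈ Edm a b := ⟨le_sup_left, hx.le.trans inf_le_right⟩
  have mem₂ : (x, a (x ⊔ x') ⊓ b x) ∈ Edm a b := ⟨le_sup_left.trans hx.le, inf_le_right⟩
  have mem₃ : (x', a x') ∈ Edm a b := ⟨le_rfl, hab x'⟩
  have mem_bot : (x ⊓ x', a x' ⊓ b (x ⊓ x')) ∈ Edm a b :=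
    ⟨le_inf (hma inf_le_right) (hab _), inf_le_right⟩
  have mem_top : (x ⊔ x', a (x ⊔ x')) ∈ Edm a b := ⟨le_rfl, hab _⟩
  have h₁₂ : ((x, a x ⊔ a x') : L × M) < (x, a (x ⊔ x') ⊓ b x) :=
    Prod.mk_lt_mk_iff_right.2 hx
  have meet₁ : edmMeet b (x, a x ⊔ a x') (x', a x') = (x ⊓ x', a x' ⊓ b (x ⊓ x')) := by
    simp only [edmMeet, inf_eq_right.2 (le_sup_right : a x' ≤ a x ⊔ a x')]
  have meet₂ : edmMeet b (x, a (x ⊔ x') ⊓ b x) (x', a x') =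
      (x ⊓ x', a x' ⊓ b (x ⊓ x')) := by
    simp only [edmMeet, inf_eq_right.2 ha']
  have join₁ : edmJoin a (x, a x ⊔ a x') (x', a x') = (x ⊔ x', a (x ⊔ x')) := by
    simp only [edmJoin, sup_eq_right.2 (sup_le hsup (le_sup_right.trans hsup))]
  have join₂ : edmJoin a (x, a (x ⊔ x') ⊓ b x) (x', a x') = (x ⊔ x', a (x ⊔ x')) := by
    simp only [edmJoin, sup_eq_right.2 (sup_le inf_le_left (le_sup_right.trans hsup))]
  have hm₁ : ((x ⊓ x', a x' ⊓ b (x ⊓ x')) : L × M) < (x, a x ⊔ a x') :=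
    Prod.mk_lt_mk.2 (.inl ⟨inf_lt_left.2 hnle, inf_le_left.trans le_sup_right⟩)
  have h₂j : ((x, a (x ⊔ x') ⊓ b x) : L × M) < (x ⊔ x', a (x ⊔ x')) :=
    Prod.mk_lt_mk.2 (.inl ⟨left_lt_sup.2 hnle', inf_le_left⟩)
  have hm₃ : ((x ⊓ x', a x' ⊓ b (x ⊓ x')) : L × M) < (x', a x') :=
    Prod.mk_lt_mk.2 (.inl ⟨inf_lt_right.2 hnle', inf_le_left⟩)
  have h₃j : ((x', a x') : L × M) < (x ⊔ x', a (x ⊔ x')) :=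
    Prod.mk_lt_mk.2 (.inl ⟨right_lt_sup.2 hnle, hma le_sup_right⟩)
  refine ⟨mem₁, mem₂, mem₃, h₁₂, meet₁, meet₂, join₁, join₂, hm₁, h₂j, hm₃, h₃j,
    fun h => hnle h.1, fun h => hnle' h.1, fun h => hnle h.1, fun h => hnle' h.1,
    edmJoin_mem_and_edmMeet_mem_of_pentagon ?_ hm₁.le h₁₂.le h₂j.le hm₃.le h₃j.le
      meet₁ meet₂ join₁ join₂⟩
  rintro u (rfl | rfl | rfl | rfl | rfl) <;> assumption
end
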